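/- arXiv:2504.00700 — 2 statements merged into one kernel-verified Lean document; each statement's English description precedes it below -/
import Mathlib

section
/- For B ≥ 3 one has B⁶ ≪ E(B) ≪ B⁶·(max{1, log log log B})⁸. -/
open Filter MeasureTheory Finset Topology
open scoped ENNReal

noncomputable section

/-- Euclidean norm of an integer quadruple. -/
def znorm (a : Fin 4 → ℤ) : ℝ := Real.sqrt (∑ i, ((a i : ℝ)) ^ 2)

/-- Euclidean norm of a natural-number quadruple. -/
def pnorm (x : Fin 4 → ℕ) : ℝ := Real.sqrt (∑ i, ((x i : ℝ)) ^ 2)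

/-- Sup-norm `|a| = maxᵢ |aᵢ|` of an integer quadruple. -/
def snorm (a : Fin 4 → ℤ) : ℕ := Finset.univ.sup fun i => (a i).natAbs

/-- Min of the absolute values of the coordinates. -/
def minAbs (a : Fin 4 → ℤ) : ℕ := Finset.univ.inf' Finset.univ_nonempty fun i => (a i).natAbs

/-- `a` is primitive: all coordinates nonzero and gcd of the coordinates is 1. -/
def IsPrimitive (a : Fin 4 → ℤ) : Prop := (∀ i, a i ≠ 0) ∧ Finset.univ.gcd a = 1

/-- `a` is locally solvable: it is primitive, its coordinates are not all of the same
sign, and for every prime `p` the congruence `⟨a,x⟩ ≡ 0 (mod p)` has a solution in the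
reduced residues mod `p`. -/
def IsLocSolv (a : Fin 4 → ℤ) : Prop :=
  IsPrimitive a ∧ ¬ ((∀ i, 0 < a i) ∨ (∀ i, a i < 0)) ∧
  ∀ p : ℕ, p.Prime → ∃ x : Fin 4 → (ZMod p)ˣ,
    ∑ i, (a i : ZMod p) * ((x i : (ZMod p)ˣ) : ZMod p) = 0

/-- The set `L(a)` of quadruples of primes solving `⟨a,p⟩ = 0`. -/
def Lsol (a : Fin 4 → ℤ) : Set (Fin 4 → ℕ) :=
  {p | (∀ i, (p i).Prime) ∧ ∑ i, a i * (p i : ℤ) = 0}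

/-- `𝔪(a)`: the minimum of `|p|` over prime solutions `p ∈ L(a)`, and `∞` if there is
no solution. -/
def mfrak (a : Fin 4 → ℤ) : ℝ≥0∞ :=
  ⨅ p ∈ Lsol a, ((Finset.univ.sup p : ℕ) : ℝ≥0∞)

/-- The condition `𝔪(a)³ ≤ |a|·(log |a|)⁴·(log log |a|)`. -/
def SmallSol (a : Fin 4 → ℤ) : Prop :=
  (mfrak a) ^ 3 ≤ ENNReal.ofReal ((snorm a : ℝ) * (Real.log (snorm a)) ^ 4 *
    Real.log (Real.log (snorm a)))

/-- `𝕃^loc(A)`. -/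
def LlocSet (A : ℝ) : Set (Fin 4 → ℤ) := {a | IsLocSolv a ∧ znorm a ≤ A}

/-- `𝕃(A)`. -/
def LSet (A : ℝ) : Set (Fin 4 → ℤ) := {a | IsPrimitive a ∧ znorm a ≤ A}

/-- `𝒫(B)`: quadruples of primes of sup-norm at most `B`. -/
def PP (B : ℝ) : Set (Fin 4 → ℕ) := {x | ∀ i, (x i).Prime ∧ (x i : ℝ) ≤ B}

/-- The counting function `N_a(B)`. -/
def NB (a : Fin 4 → ℤ) (B : ℝ) : ℝ :=
  (Real.log B) ^ 4 * (Set.ncard {x | x ∈ PP B ∧ ∑ i, a i * (x i : ℤ) = 0} : ℝ)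

/-- `w = log log B / log log log B`. -/
def wB (B : ℝ) : ℝ := Real.log (Real.log B) / Real.log (Real.log (Real.log B))

/-- `W = ∏_{p ≤ w} p^(⌈log w/log p⌉ + 1)`. -/
def WB (B : ℝ) : ℕ :=
  ∏ p ∈ Finset.filter Nat.Prime (Finset.range (⌊wB B⌋₊ + 1)),
    p ^ (⌈Real.log (wB B) / Real.log (p : ℝ)⌉₊ + 1)

/-- `rad(W) = ∏_{p ≤ w} p`. -/
def radWB (B : ℝ) : ℕ :=
  ∏ p ∈ Finset.filter Nat.Prime (Finset.range (⌊wB B⌋₊ + 1)), p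

/-- The local counting function `N_a^loc(B)`; the summation condition is
`a ∈ Λ_x^(W) ∩ 𝒞_x^(α)` with `α = log B`. -/
def NlocB (a : Fin 4 → ℤ) (B : ℝ) : ℝ :=
  (Real.log B) ^ 4 * (Real.log B * (WB B : ℝ) / znorm a) *
    ∑ᶠ x ∈ {x : Fin 4 → ℕ | x ∈ PP B ∧ ((WB B : ℤ) ∣ ∑ i, a i * (x i : ℤ)) ∧
      |∑ i, (x i : ℝ) * (a i : ℝ)| ≤ pnorm x * znorm a / (2 * Real.log B)},
      1 / pnorm x

/-- Gram determinant `‖u‖²‖v‖² − ⟨u,v⟩²` of a pair of real vectors. -/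
def gram2 (u v : Fin 4 → ℝ) : ℝ :=
  (∑ i, u i ^ 2) * (∑ i, v i ^ 2) - (∑ i, u i * v i) ^ 2

/-- Determinant of a rank-2 lattice `S ⊆ ℤ⁴`: for such a lattice it is the minimum of
`det(ℤu ⊕ ℤv) = √(‖u‖²‖v‖² − ⟨u,v⟩²)` over linearly independent pairs `u, v ∈ S`
(the minimum being attained precisely at bases of `S`). -/
def latDet2 (S : Set (Fin 4 → ℤ)) : ℝ :=
  sInf {d : ℝ | ∃ u ∈ S, ∃ v ∈ S,
    (∀ m n : ℤ, m • u + n • v = 0 → m = 0 ∧ n = 0) ∧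
    d = Real.sqrt (gram2 (fun i => (u i : ℝ)) (fun i => (v i : ℝ)))}

/-- `det(Λ_x ∩ Λ_y)` for quadruples of primes `x, y`. -/
def detXY (x y : Fin 4 → ℕ) : ℝ :=
  latDet2 {z | (∑ i, (x i : ℤ) * z i) = 0 ∧ (∑ i, (y i : ℤ) * z i) = 0}

/-- `Ω(B)`: pairs of distinct quadruples of primes of size at most `B`. -/
def OmegaB (B : ℝ) : Set ((Fin 4 → ℕ) × (Fin 4 → ℕ)) :=
  {p | p.1 ∈ PP B ∧ p.2 ∈ PP B ∧ p.1 ≠ p.2}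

/-- `E(B)`. -/
def EB (B : ℝ) : ℝ :=
  (Real.log B) ^ 8 * ∑ᶠ p ∈ OmegaB B, 1 / detXY p.1 p.2

/-- `𝒢(x,y)`: the gcd of the 2×2 minors of the matrix with columns `x, y`. -/
def Gcal (x y : Fin 4 → ℕ) : ℤ :=
  Finset.univ.gcd fun q : Fin 4 × Fin 4 =>
    (x q.1 : ℤ) * (y q.2 : ℤ) - (x q.2 : ℤ) * (y q.1 : ℤ)

/-- `Δ(x,y) = ‖x‖‖y‖/det(ℤx ⊕ ℤy)`. -/
def DeltaXY (x y : Fin 4 → ℕ) : ℝ :=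
  pnorm x * pnorm y / Real.sqrt (gram2 (fun i => (x i : ℝ)) (fun i => (y i : ℝ)))

/-- `ℰ_{x,y}(B) = min{1, Δ(x,y)²/α²} + 𝟏[𝒢(x,y) ∤ W/rad(W)]`. -/
def EcalXY (x y : Fin 4 → ℕ) (B : ℝ) : ℝ :=
  min 1 (DeltaXY x y ^ 2 / (Real.log B) ^ 2) +
  (if Gcal x y ∣ ((WB B / radWB B : ℕ) : ℤ) then 0 else 1)

/-- `F(B)`. -/
def FB (B : ℝ) : ℝ :=
  (Real.log B) ^ 8 * ∑ᶠ p ∈ OmegaB B, EcalXY p.1 p.2 B / detXY p.1 p.2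

/-- `ζ(2)`. -/
def zeta2 : ℝ := ∑' n : ℕ, (1 : ℝ) / (n + 1) ^ 2

/-- `{a ∈ ℤ⁴_prim : ‖a‖ ≤ A}` with `ℤ⁴_prim` the tuples of coprime coordinates. -/
def primA (A : ℝ) : Set (Fin 4 → ℤ) := {a | Finset.univ.gcd a = 1 ∧ znorm a ≤ A}

/-- `D(A,B)`. -/
def DAB (A B : ℝ) : ℝ :=
  (∑ᶠ a ∈ primA A, NB a B ^ 2) - (Real.log B) ^ 4 * ∑ᶠ a ∈ primA A, NB a B

/-- `Δ_a^mix(B)`. -/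
def DeltaMix (a : Fin 4 → ℤ) (B : ℝ) : ℝ :=
  (Real.log B) ^ 8 * (Real.log B * (WB B : ℝ) / znorm a) *
    ∑ᶠ x ∈ {x : Fin 4 → ℕ | x ∈ PP B ∧ ∑ i, a i * (x i : ℤ) = 0}, 1 / pnorm x

/-- `Δ_a^loc(B)`. -/
def DeltaLoc (a : Fin 4 → ℤ) (B : ℝ) : ℝ :=
  (Real.log B) ^ 8 * ((Real.log B) ^ 2 * (WB B : ℝ) ^ 2 / znorm a ^ 2) *
    ∑ᶠ x ∈ {x : Fin 4 → ℕ | x ∈ PP B ∧ ((WB B : ℤ) ∣ ∑ i, a i * (x i : ℤ)) ∧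
      |∑ i, (x i : ℝ) * (a i : ℝ)| ≤ pnorm x * znorm a / (2 * Real.log B)},
      1 / pnorm x ^ 2

/-- `D^mix(A,B)`. -/
def DmixAB (A B : ℝ) : ℝ :=
  (∑ᶠ a ∈ primA A, NB a B * NlocB a B) - ∑ᶠ a ∈ primA A, DeltaMix a B

/-- `D^loc(A,B)`. -/
def DlocAB (A B : ℝ) : ℝ :=
  (∑ᶠ a ∈ primA A, NlocB a B ^ 2) - ∑ᶠ a ∈ primA A, DeltaLoc a B

/-- `K(A,B)`. -/
def KAB (A B : ℝ) : ℝ :=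
  ∑ᶠ a ∈ primA A, ((Real.log B) ^ 4 * NB a B + DeltaMix a B + DeltaLoc a B)

/-- `τ(a,γ) = γ·vol({u ∈ 𝓑₄(1) ∩ ℝ⁴₊ : a ∈ 𝒞_u^(γ)})`. -/
def tauA (a : Fin 4 → ℤ) (γ : ℝ) : ℝ :=
  γ * (volume {u : Fin 4 → ℝ | Real.sqrt (∑ i, u i ^ 2) < 1 ∧ (∀ i, 0 < u i) ∧
      |∑ i, u i * (a i : ℝ)| ≤ Real.sqrt (∑ i, u i ^ 2) * znorm a / (2 * γ)}).toReal

/-- The singular integral `𝔍_a(B) = τ(a, log B)`. -/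
def Jfrak (a : Fin 4 → ℤ) (B : ℝ) : ℝ := tauA a (Real.log B)

/-- `σ(a,Q) = (Q/φ(Q)⁴)·#{b ∈ ((ℤ/Qℤ)^*)⁴ : ⟨a,b⟩ ≡ 0 mod Q}`. -/
def sigmaA (a : Fin 4 → ℤ) (Q : ℕ) : ℝ :=
  (Q : ℝ) / (Nat.totient Q : ℝ) ^ 4 *
    (Nat.card {b : Fin 4 → (ZMod Q)ˣ |
      ∑ i, (a i : ZMod Q) * ((b i : (ZMod Q)ˣ) : ZMod Q) = 0} : ℝ)

/-- The truncated singular series `𝔖_a(B) = σ(a, W)`. -/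
def Sfrak (a : Fin 4 → ℤ) (B : ℝ) : ℝ := sigmaA a (WB B)

end

theorem factorial_dvd_pow_mul_prod_arith (m d K : ℕ) :
    K.factorial ∣ d ^ K * ∏ i ∈ range K, (m + i * d) := by
  rw [Nat.dvd_iff_prime_pow_dvd_dvd]
  intro p k hp hpk
  by_cases hpd : p ∣ d
  · have h1 : k ≤ K := by
      have := Fact.mk hp
      have h2 : k ≤ padicValNat p K.factorial :=
        (padicValNat_dvd_iff_le (Nat.factorial_ne_zero K)).1 hpk
      have h3 := sub_one_mul_padicValNat_factorial (p := p) K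
      have h4 : padicValNat p K.factorial ≤ (p - 1) * padicValNat p K.factorial :=
        Nat.le_mul_of_pos_left _ (by have := hp.two_le; omega)
      omega
    exact ((pow_dvd_pow p h1).trans (pow_dvd_pow_of_dvd hpd K)).mul_right _
  · have hcop : Nat.Coprime d (p ^ k) :=
      (((Nat.Prime.coprime_iff_not_dvd hp).2 hpd).pow_left k).symm
    obtain ⟨e, he⟩ : ∃ e, d * e ≡ 1 [MOD p ^ k] := by
      rcases Nat.eq_zero_or_pos k with rfl | hk
      · exact ⟨0, by simp [Nat.modEq_one]⟩
      · obtain ⟨e, he⟩ := Nat.exists_mul_mod_eq_one_of_coprime hcop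
          (Nat.one_lt_pow hk.ne' hp.one_lt)
        exact ⟨e, by rw [Nat.ModEq, he.2, Nat.mod_eq_of_lt (Nat.one_lt_pow hk.ne' hp.one_lt)]⟩
    have hecop : Nat.Coprime (p ^ k) e := by
      have h1 : Nat.gcd (d * e) (p ^ k) = 1 := by
        rw [he.gcd_eq]; simp
      exact (Nat.Coprime.coprime_mul_left h1).symm
    have h2 : e ^ K * ∏ i ∈ range K, (m + i * d) ≡ ∏ i ∈ range K, (e * m + i) [MOD p ^ k] := by
      have : e ^ K * ∏ i ∈ range K, (m + i * d) = ∏ i ∈ range K, (e * m + i * (d * e)) := by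
        rw [← Finset.card_range K, ← Finset.prod_const, card_range, ← Finset.prod_mul_distrib]
        exact prod_congr rfl fun i _ => by ring
      rw [this]
      refine Nat.ModEq.prod fun i _ => ?_
      simpa using (Nat.ModEq.refl (e * m)).add ((Nat.ModEq.refl i).mul he)
    have h3 : p ^ k ∣ ∏ i ∈ range K, (e * m + i) := by
      refine hpk.trans ?_
      rw [← Nat.ascFactorial_eq_prod_range]
      exact Nat.factorial_dvd_ascFactorial _ _
    have h4 := (h2.dvd_iff dvd_rfl).2 h3
    exact ((hecop.pow_right K).dvd_of_dvd_mul_left h4).mul_left _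

theorem factorial_mul_pow_card_le (m d K M : ℕ) (hm : 0 < m) (hd : 0 < d)
    (hM : m + (K - 1) * d ≤ M) (s : Finset ℕ) (hs : ∀ i ∈ s, i < K)
    (hp : ∀ i ∈ s, (m + i * d).Prime) (hKp : ∀ i ∈ s, K < m + i * d) :
    K.factorial * K ^ s.card ≤ (d * M) ^ K := by
  have hsub : s ⊆ range K := fun i hi => mem_range.2 (hs i hi)
  have hle : ∀ i ∈ range K, m + i * d ≤ M := fun i hi =>
    le_trans (by gcongr; have := mem_range.1 hi; omega) hM
  have hcop : Nat.Coprime K.factorial (∏ i ∈ s, (m + i * d)) := by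
    refine Nat.Coprime.prod_right fun i hi => ?_
    exact ((Nat.coprime_factorial_iff (hp i hi).one_lt.ne').2
      (by rw [(hp i hi).minFac_eq]; exact hKp i hi)).symm
  have hdvd : K.factorial * ∏ i ∈ s, (m + i * d) ∣ d ^ K * ∏ i ∈ range K, (m + i * d) :=
    hcop.mul_dvd_of_dvd_of_dvd (factorial_dvd_pow_mul_prod_arith m d K)
      ((prod_dvd_prod_of_subset _ _ _ hsub).mul_left _)
  calc K.factorial * K ^ s.card ≤ K.factorial * ∏ i ∈ s, (m + i * d) := by
        gcongr
        exact Finset.pow_card_le_prod _ _ _ fun i hi => (hKp i hi).le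
    _ ≤ d ^ K * ∏ i ∈ range K, (m + i * d) := by
        refine Nat.le_of_dvd ?_ hdvd
        exact Nat.mul_pos (pow_pos hd K) (prod_pos fun i _ => by positivity)
    _ ≤ d ^ K * M ^ K := by
        gcongr
        calc _ ≤ ∏ i ∈ range K, M := prod_le_prod' hle
          _ = _ := by simp
    _ = _ := (mul_pow _ _ _).symm

theorem card_mul_log_le (m d K M : ℕ) (hm : 0 < m) (hd : 0 < d) (hK : 2 ≤ K)
    (hM : m + (K - 1) * d ≤ M) (s : Finset ℕ) (hs : ∀ i ∈ s, i < K)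
    (hp : ∀ i ∈ s, (m + i * d).Prime) (hKp : ∀ i ∈ s, K < m + i * d) :
    (s.card : ℝ) * Real.log K ≤ K * (1 + Real.log (d * M / K)) := by
  have h := factorial_mul_pow_card_le m d K M hm hd hM s hs hp hKp
  have hK0 : (0 : ℝ) < K := by positivity
  have hM0 : 0 < M := by omega
  have hMr : (0 : ℝ) < M := by positivity
  have hdr : (0 : ℝ) < d := by positivity
  have h1 : (K : ℝ) ^ K / K.factorial ≤ Real.exp K :=
    Real.pow_div_factorial_le_exp _ hK0.le _
  have hf : (0 : ℝ) < K.factorial := by positivity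
  have h2 : K * Real.log K ≤ K + Real.log K.factorial := by
    have := Real.log_le_log (by positivity) h1
    rw [Real.log_exp, Real.log_div (by positivity) hf.ne', Real.log_pow] at this
    linarith
  have h3 : Real.log K.factorial + s.card * Real.log K ≤ K * Real.log (d * M) := by
    have h' : (K.factorial : ℝ) * K ^ s.card ≤ (d * M) ^ K := by exact_mod_cast h
    have := Real.log_le_log (by positivity) h'
    rwa [Real.log_mul hf.ne' (by positivity), Real.log_pow, Real.log_pow] at this
  rw [Real.log_div (by positivity) hK0.ne']
  linarith

theorem primeCounting_le_mul_div_log :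
    ∃ C : ℝ, 0 < C ∧ ∀ x : ℝ, 2 ≤ x → (Nat.primeCounting ⌊x⌋₊ : ℝ) ≤ C * x / Real.log x := by
  refine ⟨2 * Real.log 4 + 2, by positivity, fun x hx => ?_⟩
  have h := Chebyshev.pi_le_log4_mul_div (x := x) (by linarith)
  have hl : 0 < Real.log x := Real.log_pos (by linarith)
  have hs : 0 < √x := Real.sqrt_pos.2 (by linarith)
  rw [Real.log_sqrt (by linarith)] at h
  have h1 : √x ≤ 2 * x / Real.log x := by
    rw [le_div_iff₀ hl]
    have h2 : Real.log √x ≤ √x := (Real.log_le_sub_one_of_pos hs).trans (by linarith)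
    rw [Real.log_sqrt (by linarith)] at h2
    nlinarith [Real.mul_self_sqrt (show 0 ≤ x by linarith)]
  calc _ ≤ _ := h
    _ ≤ Real.log 4 * x / (Real.log x / 2) + 2 * x / Real.log x := by gcongr
    _ = _ := by field_simp

theorem mul_div_log_le_primeCounting :
    ∃ c : ℝ, 0 < c ∧ ∀ x : ℝ, 3 ≤ x → c * x / Real.log x ≤ (Nat.primeCounting ⌊x⌋₊ : ℝ) := by
  have h4 : ∀ᶠ x : ℝ in Filter.atTop, Real.log 2 / 4 * x / Real.log x ≤
      (Nat.primeCounting ⌊x⌋₊ : ℝ) := by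
    have h5 := Real.isLittleO_log_id_atTop.bound (show 0 < Real.log 2 / 4 by positivity)
    filter_upwards [h5, Filter.eventually_ge_atTop 10] with x h5 hx
    have hl : 0 < Real.log x := Real.log_pos (by linarith)
    refine le_trans ?_ (Chebyshev.pi_ge' (x := x) (by linarith))
    gcongr
    have h6 : Real.log (x + 2) ≤ Real.log x + Real.log 2 := by
      rw [← Real.log_mul (by positivity) (by positivity)]
      exact Real.log_le_log (by linarith) (by linarith)
    simp only [Real.norm_eq_abs, id, abs_of_pos hl, abs_of_pos (show 0 < x by linarith)] at h5
    nlinarith [Real.log_pos one_lt_two]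
  obtain ⟨X, hX⟩ := Filter.eventually_atTop.1 h4
  set Y := max X 3
  have hY : 3 ≤ Y := le_max_right _ _
  have hYl : 0 < Real.log Y := Real.log_pos (by linarith)
  refine ⟨min (Real.log 2 / 4) (1 / Y), by positivity, fun x hx => ?_⟩
  have hl : 1 ≤ Real.log x := by
    rw [Real.le_log_iff_exp_le (by linarith)]
    exact (Real.exp_one_lt_three.le).trans hx
  by_cases hxY : Y ≤ x
  · refine le_trans ?_ (hX x ((le_max_left _ _).trans hxY))
    gcongr
    exact min_le_left _ _
  · have h1 : (1 : ℝ) ≤ Nat.primeCounting ⌊x⌋₊ := by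
      have : Nat.primeCounting 2 ≤ Nat.primeCounting ⌊x⌋₊ :=
        Nat.monotone_primeCounting (Nat.le_floor (by push_cast; linarith))
      have h2 : Nat.primeCounting 2 = 1 := by decide
      exact_mod_cast h2 ▸ this
    refine le_trans ?_ h1
    rw [div_le_one (by linarith)]
    calc _ ≤ 1 / Y * Y := by
          gcongr
          · exact min_le_right _ _
          · linarith
      _ = 1 := by field_simp
      _ ≤ _ := hl

theorem card_prime_arith_le :
    ∃ C : ℝ, 0 < C ∧ ∀ (B : ℝ) (m d K : ℕ), 3 ≤ B → 0 < m → 0 < d → 0 < K →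
      ((m + (K - 1) * d : ℕ) : ℝ) ≤ B →
      (((range K).filter fun i => (m + i * d).Prime).card : ℝ) ≤
        C * ((K : ℝ) ^ (5 / 6 : ℝ) * B ^ (1 / 6 : ℝ)) / Real.log B := by
  obtain ⟨C₁, hC₁, hpi⟩ := primeCounting_le_mul_div_log
  have h5 := Real.isLittleO_log_id_atTop.bound (show (0 : ℝ) < 1 / 12 by norm_num)
  obtain ⟨L₀, hL₀⟩ := Filter.eventually_atTop.1 h5
  set C := max 1 (max (2 * L₀) (2 * (C₁ + 13) * 2))
  refine ⟨C, by positivity, fun B m d K hB hm hd hK hMB => ?_⟩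
  have hB0 : 0 < B := by linarith
  have hl : 1 ≤ Real.log B := by
    rw [Real.le_log_iff_exp_le (by linarith)]
    exact (Real.exp_one_lt_three.le).trans hB
  have hl0 : 0 < Real.log B := by linarith
  have hK0 : (0 : ℝ) < K := by positivity
  have hK1 : (1 : ℝ) ≤ K := by exact_mod_cast hK
  set P := (range K).filter fun i => (m + i * d).Prime
  have hPK : (P.card : ℝ) ≤ K := by
    have := card_filter_le (range K) fun i => (m + i * d).Prime
    rw [card_range] at this
    exact_mod_cast this
  have hKd : (K - 1) + 1 ≤ m + (K - 1) * d := by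
    have := Nat.le_mul_of_pos_right (K - 1) hd
    omega
  have hKB : (K : ℝ) ≤ B := by
    refine le_trans ?_ hMB
    exact_mod_cast (show K ≤ m + (K - 1) * d by omega)
  have hsplit : (K : ℝ) = (K : ℝ) ^ (5 / 6 : ℝ) * (K : ℝ) ^ (1 / 6 : ℝ) := by
    rw [← Real.rpow_add hK0]; norm_num
  rw [le_div_iff₀ hl0]
  rcases lt_or_ge (Real.log B) L₀ with hsmall | hbig
  · calc (P.card : ℝ) * Real.log B ≤ K * L₀ := by gcongr
      _ ≤ ((K : ℝ) ^ (5 / 6 : ℝ) * B ^ (1 / 6 : ℝ)) * L₀ := by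
        have : 0 ≤ L₀ := by linarith
        nth_rewrite 1 [hsplit]
        gcongr
      _ ≤ C * ((K : ℝ) ^ (5 / 6 : ℝ) * B ^ (1 / 6 : ℝ)) := by
        rw [mul_comm]
        gcongr
        have : 2 * L₀ ≤ C := (le_max_left _ _).trans (le_max_right _ _)
        linarith
  rcases le_or_gt ((K : ℝ) * Real.log B ^ 6) B with hKs | hKl
  · have h1 : (K : ℝ) ^ (1 / 6 : ℝ) * Real.log B ≤ B ^ (1 / 6 : ℝ) := by
      have := Real.rpow_le_rpow (by positivity) hKs (show (0 : ℝ) ≤ 1 / 6 by norm_num)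
      rw [Real.mul_rpow hK0.le (by positivity), ← Real.rpow_natCast (Real.log B) 6,
        ← Real.rpow_mul hl0.le] at this
      norm_num at this ⊢
      exact this
    calc (P.card : ℝ) * Real.log B ≤ K * Real.log B := by gcongr
      _ = (K : ℝ) ^ (5 / 6 : ℝ) * ((K : ℝ) ^ (1 / 6 : ℝ) * Real.log B) := by
        rw [← mul_assoc, ← hsplit]
      _ ≤ 1 * ((K : ℝ) ^ (5 / 6 : ℝ) * B ^ (1 / 6 : ℝ)) := by rw [one_mul]; gcongr
      _ ≤ _ := by gcongr; exact le_max_left _ _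
  · have hlogK : Real.log B / 2 ≤ Real.log K := by
      have h1 := hL₀ _ hbig
      simp only [Real.norm_eq_abs, id, abs_of_pos hl0] at h1
      rw [abs_of_nonneg (Real.log_nonneg hl)] at h1
      have h2 := Real.log_le_log hB0 hKl.le
      rw [Real.log_mul hK0.ne' (by positivity), Real.log_pow] at h2
      push_cast at h2
      linarith
    have hlogK0 : 0 < Real.log K := by linarith
    have hK2 : 2 ≤ K := by
      by_contra h
      have : K = 1 := by omega
      rw [this] at hlogK0
      simp at hlogK0
    set Y := 2 * B / K with hYdef
    have hY1 : 1 ≤ Y := by rw [hYdef, le_div_iff₀ hK0]; linarith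
    have hY16 : 1 ≤ Y ^ (1 / 6 : ℝ) := Real.one_le_rpow hY1 (by norm_num)
    have hKY : K * Y ^ (1 / 6 : ℝ) ≤ 2 * ((K : ℝ) ^ (5 / 6 : ℝ) * B ^ (1 / 6 : ℝ)) := by
      rw [hYdef, Real.div_rpow (by positivity) hK0.le, Real.mul_rpow (by norm_num) hB0.le]
      have h2 : (2 : ℝ) ^ (1 / 6 : ℝ) ≤ 2 := by
        calc (2 : ℝ) ^ (1 / 6 : ℝ) ≤ 2 ^ (1 : ℝ) :=
              Real.rpow_le_rpow_of_exponent_le (by norm_num) (by norm_num)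
          _ = 2 := by simp
      have hk6 : 0 < (K : ℝ) ^ (1 / 6 : ℝ) := by positivity
      nth_rewrite 1 [hsplit]
      calc _ = 2 ^ (1 / 6 : ℝ) * ((K : ℝ) ^ (5 / 6 : ℝ) * B ^ (1 / 6 : ℝ)) := by field_simp
        _ ≤ _ := by gcongr
    set M := m + (K - 1) * d
    set s := P.filter fun i => K < m + i * d
    set s' := P.filter fun i => ¬ K < m + i * d
    have hcard : P.card = s.card + s'.card := (card_filter_add_card_filter_not _).symm
    have hs := card_mul_log_le m d K M hm hd hK2 le_rfl s
      (fun i hi => mem_range.1 (mem_filter.1 (mem_filter.1 hi).1).1)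
      (fun i hi => (mem_filter.1 (mem_filter.1 hi).1).2) (fun i hi => (mem_filter.1 hi).2)
    have hs' : (s'.card : ℝ) ≤ C₁ * K / Real.log K := by
      have h1 := hpi K (by exact_mod_cast hK2)
      rw [Nat.floor_natCast] at h1
      refine le_trans ?_ h1
      rw [← Nat.primesLE_card_eq_primeCounting]
      norm_cast
      refine card_le_card_of_injOn (fun i => m + i * d) (fun i hi => ?_) ?_
      · have h2 := mem_filter.1 hi
        have h3 := (mem_filter.1 h2.1).2
        simp only [Nat.mem_primesLE, mem_coe]
        exact ⟨by omega, h3⟩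
      · intro i _ j _ hij
        have : i * d = j * d := by simpa using hij
        exact Nat.eq_of_mul_eq_mul_right hd this
    have hdM : (d : ℝ) * M / K ≤ Y ^ 2 := by
      have h1 : (K : ℝ) * d ≤ 2 * B := by
        have h2 : ((K - 1 : ℕ) : ℝ) * d ≤ B := by
          refine le_trans ?_ hMB
          exact_mod_cast Nat.le_add_left _ _
        have h3 : (K : ℝ) ≤ 2 * ((K - 1 : ℕ) : ℝ) := by exact_mod_cast (show K ≤ 2 * (K - 1) by omega)
        have : (0 : ℝ) < d := by positivity
        nlinarith
      rw [hYdef, div_pow, div_le_div_iff₀ hK0 (by positivity)]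
      calc (d : ℝ) * M * K ^ 2 = (K * d) * M * K := by ring
        _ ≤ (2 * B) * (2 * B) * K := by gcongr; linarith
        _ = _ := by ring
    have hlogY : Real.log (d * M / K) ≤ 12 * Y ^ (1 / 6 : ℝ) := by
      have hM0 : 0 < M := by omega
      calc Real.log (d * M / K) ≤ Real.log (Y ^ 2) := Real.log_le_log (by positivity) hdM
        _ = 2 * Real.log Y := by rw [Real.log_pow]; norm_num
        _ ≤ 2 * (Y ^ (1 / 6 : ℝ) / (1 / 6)) := by
          gcongr
          exact Real.log_le_rpow_div (by linarith) (by norm_num)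
        _ = _ := by ring
    have hs2 : (s.card : ℝ) * Real.log K ≤ 13 * (K * Y ^ (1 / 6 : ℝ)) := by
      refine hs.trans ?_
      have : K * (1 + Real.log (d * M / K)) ≤ K * (Y ^ (1 / 6 : ℝ) + 12 * Y ^ (1 / 6 : ℝ)) := by
        gcongr
      linarith
    have hs2' : (s'.card : ℝ) * Real.log K ≤ C₁ * (K * Y ^ (1 / 6 : ℝ)) := by
      rw [le_div_iff₀ hlogK0] at hs'
      refine hs'.trans ?_
      gcongr
      exact le_mul_of_one_le_right hK0.le hY16
    have hC : 2 * (C₁ + 13) * 2 ≤ C := (le_max_right _ _).trans (le_max_right _ _)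
    calc (P.card : ℝ) * Real.log B ≤ P.card * (2 * Real.log K) :=
          mul_le_mul_of_nonneg_left (by linarith) (Nat.cast_nonneg _)
      _ = 2 * (s.card * Real.log K + s'.card * Real.log K) := by rw [hcard]; push_cast; ring
      _ ≤ 2 * (C₁ + 13) * (K * Y ^ (1 / 6 : ℝ)) := by linarith
      _ ≤ 2 * (C₁ + 13) * (2 * ((K : ℝ) ^ (5 / 6 : ℝ) * B ^ (1 / 6 : ℝ))) :=
        mul_le_mul_of_nonneg_left hKY (by positivity)
      _ = 2 * (C₁ + 13) * 2 * ((K : ℝ) ^ (5 / 6 : ℝ) * B ^ (1 / 6 : ℝ)) := by ring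
      _ ≤ _ := by gcongr

theorem card_prime_modEq_le :
    ∃ C : ℝ, 0 < C ∧ ∀ (B H : ℝ) (d : ℕ) (S : Finset ℕ), 3 ≤ B → 0 < d →
      (∀ p ∈ S, p.Prime ∧ (p : ℝ) ≤ B) → (∀ p ∈ S, ∀ q ∈ S, p ≡ q [MOD d]) →
      (∀ p ∈ S, ∀ q ∈ S, (q : ℝ) - p ≤ H) →
      (S.card : ℝ) ≤ C * (max 1 (H / d)) ^ (5 / 6 : ℝ) * B ^ (1 / 6 : ℝ) / Real.log B := by
  obtain ⟨C, hC, h⟩ := card_prime_arith_le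
  refine ⟨C * 2, by positivity, fun B H d S hB hd hS hmod hH => ?_⟩
  have hB0 : 0 < B := by linarith
  have hl0 : 0 < Real.log B := Real.log_pos (by linarith)
  rcases S.eq_empty_or_nonempty with rfl | hne
  · simp only [card_empty, Nat.cast_zero]
    positivity
  set m := S.min' hne
  set M := S.max' hne
  have hm : m ∈ S := S.min'_mem hne
  have hM : M ∈ S := S.max'_mem hne
  have hmM : m ≤ M := S.min'_le M hM
  set K := (M - m) / d + 1
  have hMK : m + (K - 1) * d ≤ M := by
    have : (K - 1) * d ≤ M - m := by simpa [K] using Nat.div_mul_le_self (M - m) d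
    omega
  have hd0 : (0 : ℝ) < d := by positivity
  have h1 := h B m d K hB (hS m hm).1.pos hd (Nat.succ_pos _)
    (le_trans (by exact_mod_cast hMK) (hS M hM).2)
  have hK : (K : ℝ) ≤ 2 * max 1 (H / d) := by
    have h2 : (((M - m) / d : ℕ) : ℝ) ≤ H / d := by
      refine Nat.cast_div_le.trans ?_
      rw [Nat.cast_sub hmM]
      gcongr
      exact hH m hm M hM
    have h3 := le_max_left 1 (H / d)
    have h4 := le_max_right 1 (H / d)
    simp only [K]
    push_cast
    linarith
  have hcard : S.card ≤ ((range K).filter fun i => (m + i * d).Prime).card := by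
    have hr : ∀ p ∈ S, m + (p - m) / d * d = p := fun p hp => by
      have h2 : m ≤ p := S.min'_le p hp
      have h3 : d ∣ p - m := (Nat.modEq_iff_dvd' h2).1 (hmod m hm p hp)
      rw [Nat.div_mul_cancel h3]
      omega
    refine card_le_card_of_injOn (fun p => (p - m) / d) (fun p hp => ?_) ?_
    · simp only [coe_filter, mem_range, Set.mem_ofPred_eq]
      refine ⟨Nat.lt_succ_of_le (Nat.div_le_div_right ?_), ?_⟩
      · have := S.le_max' p hp
        omega
      · rw [hr p hp]
        exact (hS p hp).1
    · intro p hp q hq hpq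
      rw [← hr p hp, ← hr q hq]
      simp only at hpq
      rw [hpq]
  have h2 : (K : ℝ) ^ (5 / 6 : ℝ) ≤ 2 * max 1 (H / d) ^ (5 / 6 : ℝ) := by
    calc (K : ℝ) ^ (5 / 6 : ℝ) ≤ (2 * max 1 (H / d)) ^ (5 / 6 : ℝ) := by gcongr
      _ = 2 ^ (5 / 6 : ℝ) * max 1 (H / d) ^ (5 / 6 : ℝ) :=
        Real.mul_rpow (by norm_num) (by positivity)
      _ ≤ _ := by
        gcongr
        calc (2 : ℝ) ^ (5 / 6 : ℝ) ≤ 2 ^ (1 : ℝ) :=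
              Real.rpow_le_rpow_of_exponent_le (by norm_num) (by norm_num)
          _ = 2 := by simp
  calc (S.card : ℝ) ≤ _ := by exact_mod_cast hcard
    _ ≤ _ := h1
    _ ≤ C * ((2 * max 1 (H / d) ^ (5 / 6 : ℝ)) * B ^ (1 / 6 : ℝ)) / Real.log B := by gcongr
    _ = _ := by ring

/-- The six Plücker coordinates of a pair of integer quadruples. -/
def plucker (u v : Fin 4 → ℤ) : Fin 6 → ℤ :=
  ![u 0 * v 1 - u 1 * v 0, u 0 * v 2 - u 2 * v 0, u 0 * v 3 - u 3 * v 0,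
    u 1 * v 2 - u 2 * v 1, u 1 * v 3 - u 3 * v 1, u 2 * v 3 - u 3 * v 2]

/-- The sum of the squares of the Plücker coordinates. -/
def pluckerSq (u v : Fin 4 → ℤ) : ℤ := ∑ I, plucker u v I ^ 2

/-- A pair of integer quadruples whose Plücker coordinates are coprime. -/
def PrimPair (u v : Fin 4 → ℤ) : Prop := ∀ k : ℤ, (∀ I, k ∣ plucker u v I) → IsUnit k

theorem pluckerSq_eq (u v : Fin 4 → ℤ) :
    pluckerSq u v = (∑ i, u i ^ 2) * (∑ i, v i ^ 2) - (∑ i, u i * v i) ^ 2 := by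
  simp only [pluckerSq, plucker, Fin.sum_univ_six, Fin.sum_univ_four]
  simp
  ring

theorem gram2_cast (u v : Fin 4 → ℤ) :
    gram2 (fun i => (u i : ℝ)) (fun i => (v i : ℝ)) = (pluckerSq u v : ℝ) := by
  rw [pluckerSq_eq, gram2]
  push_cast
  rfl

theorem dvd_plucker_iff (k : ℤ) (u v : Fin 4 → ℤ) :
    (∀ I, k ∣ plucker u v I) ↔ ∀ i j, k ∣ u i * v j - u j * v i := by
  constructor
  · intro h i j
    have h0 := h 0
    have h1 := h 1
    have h2 := h 2
    have h3 := h 3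
    have h4 := h 4
    have h5 := h 5
    simp only [plucker] at h0 h1 h2 h3 h4 h5
    fin_cases i <;> fin_cases j <;> first
      | (simp; done)
      | exact h0
      | exact h1
      | exact h2
      | exact h3
      | exact h4
      | exact h5
      | exact (dvd_sub_comm).1 h0
      | exact (dvd_sub_comm).1 h1
      | exact (dvd_sub_comm).1 h2
      | exact (dvd_sub_comm).1 h3
      | exact (dvd_sub_comm).1 h4
      | exact (dvd_sub_comm).1 h5
  · intro h I
    fin_cases I <;> exact h _ _

theorem pluckerSq_pos_iff (u v : Fin 4 → ℤ) : 0 < pluckerSq u v ↔ ∃ I, plucker u v I ≠ 0 := by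
  rw [pluckerSq, sum_pos_iff_of_nonneg fun _ _ => sq_nonneg _]
  simp [sq_pos_iff]

theorem pluckerSq_pos_iff' (u v : Fin 4 → ℤ) :
    0 < pluckerSq u v ↔ ∃ i j, u i * v j - u j * v i ≠ 0 := by
  rw [pluckerSq_pos_iff]
  have := dvd_plucker_iff 0 u v
  simp only [zero_dvd_iff] at this
  rw [← not_iff_not]
  push Not
  exact this

theorem pluckerSq_pos_iff_independent (u v : Fin 4 → ℤ) :
    (∀ m n : ℤ, m • u + n • v = 0 → m = 0 ∧ n = 0) ↔ 0 < pluckerSq u v := by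
  rw [pluckerSq_pos_iff']
  constructor
  · intro h
    by_contra! hc
    by_cases hu : u = 0
    · exact one_ne_zero (h 1 0 (by simp [hu])).1
    · obtain ⟨i, hi⟩ := Function.ne_iff.1 hu
      refine hi (neg_eq_zero.1 (h (v i) (-(u i)) ?_).2)
      ext j
      have := hc i j
      simp
      linarith
  · rintro ⟨i, j, hij⟩ m n h
    have hi := congrFun h i
    have hj := congrFun h j
    simp at hi hj
    constructor
    · refine (mul_eq_zero.1 (?_ : m * (u i * v j - u j * v i) = 0)).resolve_right hij
      linear_combination v j * hi - v i * hj
    · refine (mul_eq_zero.1 (?_ : n * (u i * v j - u j * v i) = 0)).resolve_right hij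
      linear_combination u i * hj - u j * hi

theorem PrimPair.pos {u v : Fin 4 → ℤ} (h : PrimPair u v) : 0 < pluckerSq u v := by
  rw [pluckerSq_pos_iff]
  by_contra! hc
  exact not_isUnit_zero (h 0 fun I => by rw [hc I])

theorem PrimPair.dvd_of_forall_dvd_mul {u v : Fin 4 → ℤ} (h : PrimPair u v) {k a : ℤ}
    (hk : ∀ I, k ∣ a * plucker u v I) : k ∣ a := by
  have hg : IsUnit (univ.gcd (plucker u v)) := h _ fun I => gcd_dvd (mem_univ I)
  have h1 : k ∣ univ.gcd fun I => a * plucker u v I := dvd_gcd fun I _ => hk I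
  rw [Finset.gcd_mul_left] at h1
  have h2 := (hg.dvd_mul_right).1 h1
  exact (dvd_normalize_iff).1 h2

theorem PrimPair.exists_eq_smul {u v : Fin 4 → ℤ} (h : PrimPair u v) {q : Fin 6 → ℤ}
    (hq : ∀ I J, plucker u v I * q J = plucker u v J * q I) :
    ∃ t : ℤ, ∀ I, q I = t * plucker u v I := by
  obtain ⟨I, hI⟩ := (pluckerSq_pos_iff u v).1 h.pos
  obtain ⟨t, ht⟩ := h.dvd_of_forall_dvd_mul (k := plucker u v I) (a := q I)
    fun J => ⟨q J, by linear_combination -hq I J⟩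
  refine ⟨t, fun J => mul_left_cancel₀ hI ?_⟩
  rw [hq I J, ht]
  ring

theorem PrimPair.exists_eq_add {u v x : Fin 4 → ℤ} (h : PrimPair u v) {k a b : ℤ} (hk : k ≠ 0)
    (hx : k • x = a • u + b • v) : ∃ a' b' : ℤ, x = a' • u + b' • v := by
  have hxi : ∀ i, k * x i = a * u i + b * v i := fun i => by simpa using congrFun hx i
  obtain ⟨a', rfl⟩ : k ∣ a := h.dvd_of_forall_dvd_mul <| by
    have := (dvd_plucker_iff k (a • u) v).2 fun i j => ⟨x i * v j - x j * v i, by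
      simp only [Pi.smul_apply, smul_eq_mul]
      linear_combination v i * hxi j - v j * hxi i⟩
    intro I
    convert this I using 1
    fin_cases I <;> simp [plucker] <;> ring
  obtain ⟨b', rfl⟩ : k ∣ b := h.dvd_of_forall_dvd_mul <| by
    have := (dvd_plucker_iff k u (b • v)).2 fun i j => ⟨u i * x j - u j * x i, by
      simp only [Pi.smul_apply, smul_eq_mul]
      linear_combination u j * hxi i - u i * hxi j⟩
    intro I
    convert this I using 1
    fin_cases I <;> simp [plucker] <;> ring
  refine ⟨a', b', ?_⟩
  ext i
  refine mul_left_cancel₀ hk ?_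
  rw [hxi]
  simp
  ring

set_option maxHeartbeats 2000000 in
theorem PrimPair.exists_pluckerSq_eq {u v z w : Fin 4 → ℤ} (h : PrimPair u v)
    (huz : ∑ i, u i * z i = 0) (huw : ∑ i, u i * w i = 0) (hvz : ∑ i, v i * z i = 0)
    (hvw : ∑ i, v i * w i = 0) : ∃ t : ℤ, pluckerSq z w = t ^ 2 * pluckerSq u v := by
  have key : ∀ i l, ∑ j, (u i * v j - u j * v i) * (z j * w l - z l * w j) = 0 := by
    intro i l
    have : ∑ j, (u i * v j - u j * v i) * (z j * w l - z l * w j) =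
        u i * w l * (∑ j, v j * z j) - u i * z l * (∑ j, v j * w j) -
        v i * w l * (∑ j, u j * z j) + v i * z l * (∑ j, u j * w j) := by
      simp only [mul_sum, ← sum_sub_distrib, ← sum_add_distrib]
      exact sum_congr rfl fun j _ => by ring
    rw [this, huz, huw, hvz, hvw]
    ring
  simp only [Fin.sum_univ_four] at key
  obtain ⟨t, ht⟩ := h.exists_eq_smul (q := ![plucker z w 5, -plucker z w 4, plucker z w 3,
      plucker z w 2, -plucker z w 1, plucker z w 0]) <| by
    have k00 := key 0 0
    have k01 := key 0 1
    have k02 := key 0 2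
    have k03 := key 0 3
    have k10 := key 1 0
    have k11 := key 1 1
    have k12 := key 1 2
    have k13 := key 1 3
    have k20 := key 2 0
    have k21 := key 2 1
    have k22 := key 2 2
    have k23 := key 2 3
    have k30 := key 3 0
    have k31 := key 3 1
    have k32 := key 3 2
    have k33 := key 3 3
    clear key
    intro I J
    fin_cases I <;> fin_cases J <;> simp [plucker] <;> linarith
  refine ⟨t, ?_⟩
  have h0 := ht 0
  have h1 := ht 1
  have h2 := ht 2
  have h3 := ht 3
  have h4 := ht 4
  have h5 := ht 5
  simp only [pluckerSq, Fin.sum_univ_six]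
  simp at h0 h1 h2 h3 h4 h5
  rw [h0, h3, h5, h2, ← sq_abs (plucker z w 1), ← sq_abs (plucker z w 4),
    ← abs_neg (plucker z w 1), ← abs_neg (plucker z w 4), h1, h4, sq_abs, sq_abs]
  ring

/-- A set of integer quadruples closed under integral combinations and under division. -/
def Saturated (L : Set (Fin 4 → ℤ)) : Prop :=
  ∀ u ∈ L, ∀ v ∈ L, ∀ (k a b : ℤ) (w : Fin 4 → ℤ), k ≠ 0 → k • w = a • u + b • v → w ∈ L

theorem pluckerSq_combination {u v z w : Fin 4 → ℤ} {a b c e k l : ℤ}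
    (hz : k • z = a • u + b • v) (hw : l • w = c • u + e • v) :
    (k * l) ^ 2 * pluckerSq z w = (a * e - b * c) ^ 2 * pluckerSq u v := by
  have hz' : ∀ i, k * z i = a * u i + b * v i := fun i => by simpa using congrFun hz i
  have hw' : ∀ i, l * w i = c * u i + e * v i := fun i => by simpa using congrFun hw i
  have : ∀ i j, (k * l) * (z i * w j - z j * w i) = (a * e - b * c) * (u i * v j - u j * v i) := by
    intro i j
    linear_combination (l * w j) * hz' i + (a * u i + b * v i) * hw' j
      - (l * w i) * hz' j - (a * u j + b * v j) * hw' i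
  simp only [pluckerSq, mul_sum, ← mul_pow]
  refine sum_congr rfl fun I _ => ?_
  congr 1
  fin_cases I <;> exact this _ _

theorem Saturated.exists_primPair {L : Set (Fin 4 → ℤ)} (hL : Saturated L) {u₀ v₀ : Fin 4 → ℤ}
    (hu₀ : u₀ ∈ L) (hv₀ : v₀ ∈ L) (h₀ : 0 < pluckerSq u₀ v₀) :
    ∃ u ∈ L, ∃ v ∈ L, PrimPair u v := by
  classical
  have hex : ∃ n : ℕ, ∃ u ∈ L, ∃ v ∈ L, 0 < pluckerSq u v ∧ (pluckerSq u v).toNat = n :=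
    ⟨_, u₀, hu₀, v₀, hv₀, h₀, rfl⟩
  obtain ⟨u, hu, v, hv, hpos, hn⟩ := Nat.find_spec hex
  have hmin : ∀ z ∈ L, ∀ w ∈ L, 0 < pluckerSq z w → pluckerSq u v ≤ pluckerSq z w := by
    intro z hz w hw hzw
    have := Nat.find_min' hex ⟨z, hz, w, hw, hzw, rfl⟩
    omega
  refine ⟨u, hu, v, hv, fun k hk => ?_⟩
  by_contra hunit
  obtain ⟨p, hp, hpk⟩ := Int.exists_prime_and_dvd fun h => hunit (Int.isUnit_iff_natAbs_eq.2 h)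
  have hpd := (dvd_plucker_iff p u v).1 fun I => hpk.trans (hk I)
  have hp0 : p ≠ 0 := hp.ne_zero
  have hpa : (1 : ℤ) < |p| := by
    rw [Int.abs_eq_natAbs]
    exact_mod_cast (Int.prime_iff_natAbs_prime.1 hp).one_lt
  have descent : ∀ s : ℤ, 0 < s → s < |p| → ∀ z ∈ L, ∀ w ∈ L,
      p ^ 2 * pluckerSq z w = s ^ 2 * pluckerSq u v → False := by
    intro s hs hsp z hz w hw h
    have h1 : 0 < pluckerSq z w := by
      have : 0 < s ^ 2 * pluckerSq u v := by positivity
      rw [← h] at this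
      exact pos_of_mul_pos_right this (sq_nonneg _)
    have h2 := hmin z hz w hw h1
    have h3 : s ^ 2 < p ^ 2 := by
      rw [← sq_abs p]
      nlinarith
    nlinarith
  by_cases hui : ∀ i, p ∣ u i
  · choose z hz using hui
    have hz' : p • z = (1 : ℤ) • u + (0 : ℤ) • v := by
      ext i
      simp [hz i]
    have hzL : z ∈ L := hL u hu v hv p 1 0 z hp0 hz'
    refine descent 1 one_pos hpa z hzL v hv ?_
    have := pluckerSq_combination (w := v) (l := 1) (c := 0) (e := 1) hz' (by simp)
    linear_combination this
  · push Not at hui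
    obtain ⟨i, hi⟩ := hui
    set b := (-(u i)) % p with hb
    have hbpos : 0 < b := by
      refine lt_of_le_of_ne (Int.emod_nonneg _ hp0) fun h => hi ?_
      exact (dvd_neg).1 (Int.dvd_of_emod_eq_zero h.symm)
    have hbdvd : p ∣ -(u i) - b := by
      rw [hb]
      exact Int.dvd_self_sub_emod
    have hdiv : ∀ j, p ∣ v i * u j + b * v j := by
      intro j
      have h1 := hpd i j
      have h2 := hbdvd.mul_right (v j)
      have h3 : v i * u j + b * v j =
          -(u i * v j - u j * v i) - (-(u i) - b) * v j := by ring
      rw [h3]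
      exact (h1.neg_right).sub h2
    choose w hw using hdiv
    have hw' : p • w = (v i) • u + b • v := by
      ext j
      simp [hw j]
    have hwL : w ∈ L := hL u hu v hv p _ _ w hp0 hw'
    refine descent b hbpos (Int.emod_lt_abs _ hp0) u hu w hwL ?_
    have := pluckerSq_combination (z := u) (k := 1) (a := 1) (b := 0) (by simp) hw'
    linear_combination this

theorem Saturated.exists_reduced_primPair {L : Set (Fin 4 → ℤ)} (hL : Saturated L)
    {u₀ v₀ : Fin 4 → ℤ} (hu₀ : u₀ ∈ L) (hv₀ : v₀ ∈ L) (h₀ : 0 < pluckerSq u₀ v₀) :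
    ∃ u ∈ L, ∃ v ∈ L, PrimPair u v ∧
      3 * ((∑ i, u i ^ 2) * ∑ i, v i ^ 2) ≤ 4 * pluckerSq u v := by
  classical
  obtain ⟨u₁, hu₁, v₁, hv₁, h₁⟩ := hL.exists_primPair hu₀ hv₀ h₀
  let N : (Fin 4 → ℤ) → (Fin 4 → ℤ) → ℕ := fun u v => ((∑ i, u i ^ 2) + ∑ i, v i ^ 2).toNat
  have hex : ∃ n : ℕ, ∃ u ∈ L, ∃ v ∈ L, PrimPair u v ∧ N u v = n :=
    ⟨_, u₁, hu₁, v₁, hv₁, h₁, rfl⟩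
  obtain ⟨u, hu, v, hv, huv, hn⟩ := Nat.find_spec hex
  have hnn : ∀ u : Fin 4 → ℤ, 0 ≤ ∑ i, u i ^ 2 := fun u => sum_nonneg fun _ _ => sq_nonneg _
  have hmin : ∀ z ∈ L, ∀ w ∈ L, PrimPair z w →
      (∑ i, u i ^ 2) + ∑ i, v i ^ 2 ≤ (∑ i, z i ^ 2) + ∑ i, w i ^ 2 := by
    intro z hz w hw hzw
    have := Nat.find_min' hex ⟨z, hz, w, hw, hzw, rfl⟩
    rw [← hn] at this
    simp only [N] at this
    have h1 := hnn u
    have h2 := hnn v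
    have h3 := hnn z
    have h4 := hnn w
    omega
  refine ⟨u, hu, v, hv, huv, ?_⟩
  have hprim : ∀ z w : Fin 4 → ℤ, (∀ i j, z i * w j - z j * w i = u i * v j - u j * v i) →
      PrimPair z w := by
    intro z w h k hk
    refine huv k ((dvd_plucker_iff k u v).2 fun i j => ?_)
    rw [← h i j]
    exact (dvd_plucker_iff k z w).1 hk i j
  have hv' : ∀ s : ℤ, v + s • u ∈ L := fun s =>
    hL u hu v hv 1 s 1 _ one_ne_zero (by simp [add_comm])
  have hu' : ∀ s : ℤ, u + s • v ∈ L := fun s =>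
    hL u hu v hv 1 1 s _ one_ne_zero (by simp)
  have hv2 : ∀ s : ℤ, 0 ≤ 2 * s * (∑ i, u i * v i) + s ^ 2 * ∑ i, u i ^ 2 := by
    intro s
    have := hmin u hu _ (hv' s) (hprim _ _ fun i j => by simp; ring)
    simp only [Fin.sum_univ_four, Pi.add_apply, Pi.smul_apply, smul_eq_mul] at this ⊢
    linarith
  have hu2 : ∀ s : ℤ, 0 ≤ 2 * s * (∑ i, u i * v i) + s ^ 2 * ∑ i, v i ^ 2 := by
    intro s
    have := hmin _ (hu' s) v hv (hprim _ _ fun i j => by simp; ring)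
    simp only [Fin.sum_univ_four, Pi.add_apply, Pi.smul_apply, smul_eq_mul] at this ⊢
    linarith
  have a1 := hv2 1
  have a2 := hv2 (-1)
  have a3 := hu2 1
  have a4 := hu2 (-1)
  rw [pluckerSq_eq]
  set U := ∑ i, u i ^ 2
  set V := ∑ i, v i ^ 2
  set T := ∑ i, u i * v i
  have hT : (2 * |T|) * (2 * |T|) ≤ U * V := by
    have h1 : 2 * |T| ≤ U := by
      rcases abs_cases T with h | h <;> rw [h.1] <;> linarith
    have h2 : 2 * |T| ≤ V := by
      rcases abs_cases T with h | h <;> rw [h.1] <;> linarith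
    exact mul_le_mul h1 h2 (by positivity) (hnn u)
  have : |T| * |T| = T ^ 2 := by rw [← sq, sq_abs]
  linarith

theorem saturated_orthogonal (x y : Fin 4 → ℤ) :
    Saturated {z | ∑ i, x i * z i = 0 ∧ ∑ i, y i * z i = 0} := by
  rintro u ⟨hu1, hu2⟩ v ⟨hv1, hv2⟩ k a b w hk hw
  have hw' : ∀ i, k * w i = a * u i + b * v i := fun i => by simpa using congrFun hw i
  have aux : ∀ c : Fin 4 → ℤ, ∑ i, c i * u i = 0 → ∑ i, c i * v i = 0 → ∑ i, c i * w i = 0 := by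
    intro c h1 h2
    refine (mul_eq_zero.1 (?_ : k * ∑ i, c i * w i = 0)).resolve_left hk
    have : k * ∑ i, c i * w i = a * (∑ i, c i * u i) + b * ∑ i, c i * v i := by
      simp only [mul_sum, ← sum_add_distrib]
      exact sum_congr rfl fun i _ => by linear_combination c i * hw' i
    rw [this, h1, h2]
    ring
  exact ⟨aux x hu1 hv1, aux y hu2 hv2⟩

/-- The saturation of the lattice spanned by two integer quadruples. -/
def satSpan (x y : Fin 4 → ℤ) : Set (Fin 4 → ℤ) :=
  {w | ∃ k a b : ℤ, k ≠ 0 ∧ k • w = a • x + b • y}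

theorem saturated_satSpan (x y : Fin 4 → ℤ) : Saturated (satSpan x y) := by
  rintro u ⟨k₁, a₁, b₁, hk₁, hu⟩ v ⟨k₂, a₂, b₂, hk₂, hv⟩ k a b w hk hw
  refine ⟨k * k₁ * k₂, a * k₂ * a₁ + b * k₁ * a₂, a * k₂ * b₁ + b * k₁ * b₂, by positivity, ?_⟩
  ext i
  have h1 := congrFun hu i
  have h2 := congrFun hv i
  have h3 := congrFun hw i
  simp at h1 h2 h3 ⊢
  linear_combination k₁ * k₂ * h3 + a * k₂ * h1 + b * k₁ * h2

theorem exists_reduced_decomposition (x y : Fin 4 → ℤ) (hxy : 0 < pluckerSq x y) :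
    ∃ u v : Fin 4 → ℤ, ∃ a b c e : ℤ, x = a • u + b • v ∧ y = c • u + e • v ∧
      PrimPair u v ∧ u ∈ satSpan x y ∧ v ∈ satSpan x y ∧
      3 * ((∑ i, u i ^ 2) * ∑ i, v i ^ 2) ≤ 4 * pluckerSq u v := by
  have hx : x ∈ satSpan x y := ⟨1, 1, 0, one_ne_zero, by simp⟩
  have hy : y ∈ satSpan x y := ⟨1, 0, 1, one_ne_zero, by simp⟩
  obtain ⟨u, hu, v, hv, huv, hred⟩ :=
    (saturated_satSpan x y).exists_reduced_primPair hx hy hxy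
  obtain ⟨k₁, a₁, b₁, hk₁, hu'⟩ := id hu
  obtain ⟨k₂, a₂, b₂, hk₂, hv'⟩ := id hv
  have hdet : a₁ * b₂ - b₁ * a₂ ≠ 0 := by
    intro h
    have h1 := pluckerSq_combination hu' hv'
    rw [h] at h1
    have h2 := huv.pos
    have : 0 < (k₁ * k₂) ^ 2 * pluckerSq u v := by positivity
    rw [h1] at this
    simp at this
  have hcx : (a₁ * b₂ - b₁ * a₂) • x = (b₂ * k₁) • u + (-(b₁ * k₂)) • v := by
    ext i
    have h1 := congrFun hu' i
    have h2 := congrFun hv' i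
    simp at h1 h2 ⊢
    linear_combination -b₂ * h1 + b₁ * h2
  have hcy : (a₁ * b₂ - b₁ * a₂) • y = (-(a₂ * k₁)) • u + (a₁ * k₂) • v := by
    ext i
    have h1 := congrFun hu' i
    have h2 := congrFun hv' i
    simp at h1 h2 ⊢
    linear_combination a₂ * h1 - a₁ * h2
  obtain ⟨a, b, hab⟩ := huv.exists_eq_add hdet hcx
  obtain ⟨c, e, hce⟩ := huv.exists_eq_add hdet hcy
  exact ⟨u, v, a, b, c, e, hab, hce, huv, hu, hv, hred⟩

theorem latDet2_le {S : Set (Fin 4 → ℤ)} {z w : Fin 4 → ℤ} (hz : z ∈ S) (hw : w ∈ S)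
    (h : 0 < pluckerSq z w) : latDet2 S ≤ √(pluckerSq z w : ℝ) :=
  csInf_le ⟨0, by rintro _ ⟨u, -, v, -, -, rfl⟩; exact Real.sqrt_nonneg _⟩
    ⟨z, hz, w, hw, (pluckerSq_pos_iff_independent z w).2 h, by rw [gram2_cast]⟩

theorem one_div_latDet2_le {S : Set (Fin 4 → ℤ)} {g : ℝ} (hg : 0 < g)
    (h : ∀ z ∈ S, ∀ w ∈ S, 0 < pluckerSq z w → g ≤ √(pluckerSq z w : ℝ)) :
    1 / latDet2 S ≤ 1 / g := by
  rw [latDet2]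
  set T := {d : ℝ | ∃ u ∈ S, ∃ v ∈ S,
    (∀ m n : ℤ, m • u + n • v = 0 → m = 0 ∧ n = 0) ∧
    d = Real.sqrt (gram2 (fun i => (u i : ℝ)) (fun i => (v i : ℝ)))} with hT
  rcases T.eq_empty_or_nonempty with h0 | hne
  · rw [h0, Real.sInf_empty, div_zero]
    positivity
  · refine one_div_le_one_div_of_le hg (le_csInf hne ?_)
    rintro _ ⟨u, hu, v, hv, hi, rfl⟩
    rw [gram2_cast]
    exact h u hu v hv ((pluckerSq_pos_iff_independent u v).1 hi)

theorem one_le_latDet2 {S : Set (Fin 4 → ℤ)} {z w : Fin 4 → ℤ} (hz : z ∈ S) (hw : w ∈ S)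
    (h : 0 < pluckerSq z w) : 1 ≤ latDet2 S := by
  refine le_csInf ⟨_, z, hz, w, hw, (pluckerSq_pos_iff_independent z w).2 h, rfl⟩ ?_
  rintro _ ⟨u, hu, v, hv, hi, rfl⟩
  rw [gram2_cast, Real.one_le_sqrt]
  exact_mod_cast (pluckerSq_pos_iff_independent u v).1 hi

theorem one_div_detXY_le_one (x y : Fin 4 → ℕ) : 1 / detXY x y ≤ 1 := by
  have := one_div_latDet2_le (S := {z | (∑ i, (x i : ℤ) * z i) = 0 ∧ (∑ i, (y i : ℤ) * z i) = 0})
    one_pos fun z _ w _ h => by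
      rw [Real.one_le_sqrt]
      exact_mod_cast h
  rwa [div_one] at this

theorem one_div_detXY_nonneg (x y : Fin 4 → ℕ) : 0 ≤ 1 / detXY x y := by
  refine one_div_nonneg.2 (Real.sInf_nonneg ?_)
  rintro _ ⟨u, -, v, -, -, rfl⟩
  exact Real.sqrt_nonneg _

theorem detXY_comm (x y : Fin 4 → ℕ) : detXY x y = detXY y x := by
  simp only [detXY, and_comm]

theorem satSpan_orthogonal {x y u z : Fin 4 → ℤ} (hu : u ∈ satSpan x y)
    (hx : ∑ i, x i * z i = 0) (hy : ∑ i, y i * z i = 0) : ∑ i, u i * z i = 0 := by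
  obtain ⟨k, a, b, hk, h⟩ := hu
  refine (mul_eq_zero.1 (?_ : k * ∑ i, u i * z i = 0)).resolve_left hk
  have : k * ∑ i, u i * z i = a * (∑ i, x i * z i) + b * ∑ i, y i * z i := by
    simp only [mul_sum, ← sum_add_distrib]
    refine sum_congr rfl fun i _ => ?_
    have := congrFun h i
    simp at this
    linear_combination z i * this
  rw [this, hx, hy]
  ring

theorem one_div_detXY_le {x y : Fin 4 → ℕ} {u v : Fin 4 → ℤ} (huv : PrimPair u v)
    (hu : u ∈ satSpan (fun i => (x i : ℤ)) fun i => (y i : ℤ))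
    (hv : v ∈ satSpan (fun i => (x i : ℤ)) fun i => (y i : ℤ)) :
    1 / detXY x y ≤ 1 / √(pluckerSq u v : ℝ) := by
  have hpos := huv.pos
  refine one_div_latDet2_le (Real.sqrt_pos.2 (by exact_mod_cast hpos)) ?_
  rintro z ⟨hz1, hz2⟩ w ⟨hw1, hw2⟩ hzw
  refine Real.sqrt_le_sqrt ?_
  obtain ⟨t, ht⟩ := huv.exists_pluckerSq_eq (satSpan_orthogonal hu hz1 hz2)
    (satSpan_orthogonal hu hw1 hw2) (satSpan_orthogonal hv hz1 hz2)
    (satSpan_orthogonal hv hw1 hw2)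
  have ht0 : 0 < t ^ 2 := by
    rw [ht] at hzw
    exact pos_of_mul_pos_left hzw hpos.le
  have : pluckerSq u v ≤ pluckerSq z w := by
    rw [ht]
    nlinarith
  exact_mod_cast this

theorem exists_orthogonal_pair {x y : Fin 4 → ℤ} (h : 0 < pluckerSq x y) :
    ∃ z w : Fin 4 → ℤ, (∑ i, x i * z i = 0 ∧ ∑ i, y i * z i = 0) ∧
      (∑ i, x i * w i = 0 ∧ ∑ i, y i * w i = 0) ∧ 0 < pluckerSq z w := by
  let p := plucker x y
  let r0 : Fin 4 → ℤ := ![0, p 5, -p 4, p 3]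
  let r1 : Fin 4 → ℤ := ![-p 5, 0, p 2, -p 1]
  let r2 : Fin 4 → ℤ := ![p 4, -p 2, 0, p 0]
  let r3 : Fin 4 → ℤ := ![-p 3, p 1, -p 0, 0]
  have h0 : ∑ i, x i * r0 i = 0 ∧ ∑ i, y i * r0 i = 0 := by
    constructor <;> simp [r0, p, plucker, Fin.sum_univ_four] <;> ring
  have h1 : ∑ i, x i * r1 i = 0 ∧ ∑ i, y i * r1 i = 0 := by
    constructor <;> simp [r1, p, plucker, Fin.sum_univ_four] <;> ring
  have h2 : ∑ i, x i * r2 i = 0 ∧ ∑ i, y i * r2 i = 0 := by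
    constructor <;> simp [r2, p, plucker, Fin.sum_univ_four] <;> ring
  have h3 : ∑ i, x i * r3 i = 0 ∧ ∑ i, y i * r3 i = 0 := by
    constructor <;> simp [r3, p, plucker, Fin.sum_univ_four] <;> ring
  obtain ⟨I, hI⟩ := (pluckerSq_pos_iff x y).1 h
  have hI' : p I ≠ 0 := hI
  fin_cases I
  · exact ⟨r2, r3, h2, h3, (pluckerSq_pos_iff' _ _).2 ⟨2, 3, by simpa [r2, r3] using hI'⟩⟩
  · exact ⟨r1, r3, h1, h3, (pluckerSq_pos_iff' _ _).2 ⟨1, 3, by simpa [r1, r3] using hI'⟩⟩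
  · exact ⟨r1, r2, h1, h2, (pluckerSq_pos_iff' _ _).2 ⟨1, 2, by simpa [r1, r2] using hI'⟩⟩
  · exact ⟨r0, r3, h0, h3, (pluckerSq_pos_iff' _ _).2 ⟨0, 3, by simpa [r0, r3] using hI'⟩⟩
  · exact ⟨r0, r2, h0, h2, (pluckerSq_pos_iff' _ _).2 ⟨0, 2, by simpa [r0, r2] using hI'⟩⟩
  · exact ⟨r0, r1, h0, h1, (pluckerSq_pos_iff' _ _).2 ⟨0, 1, by simpa [r0, r1] using hI'⟩⟩

/-- Two distinct quadruples of primes are proportional only if both are constant. -/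
theorem eq_const_of_pluckerSq_eq_zero {x y : Fin 4 → ℕ} (hx : ∀ i, (x i).Prime)
    (hy : ∀ i, (y i).Prime) (hxy : x ≠ y)
    (h : ¬ 0 < pluckerSq (fun i => (x i : ℤ)) fun i => (y i : ℤ)) :
    ∃ p q : ℕ, (x = fun _ => p) ∧ y = fun _ => q := by
  rw [pluckerSq_pos_iff'] at h
  push Not at h
  have h' : ∀ i j, x i * y j = x j * y i := fun i j => by
    have := h i j
    zify
    linarith
  obtain ⟨k, hk⟩ := Function.ne_iff.1 hxy
  have hxk : ∀ j, x j = x k := fun j => by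
    have h1 : x k ∣ x j * y k := ⟨y j, (h' k j).symm⟩
    rcases (hx k).dvd_mul.1 h1 with h2 | h2
    · exact ((Nat.prime_dvd_prime_iff_eq (hx k) (hx j)).1 h2).symm
    · exact absurd ((Nat.prime_dvd_prime_iff_eq (hx k) (hy k)).1 h2) hk
  refine ⟨x k, y k, funext hxk, funext fun j => ?_⟩
  have := h' k j
  rw [hxk j] at this
  exact Nat.eq_of_mul_eq_mul_left (hx k).pos this

theorem detXY_pos_and_le {x y : Fin 4 → ℕ} (hx : ∀ i, (x i).Prime) (hy : ∀ i, (y i).Prime)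
    (hxy : x ≠ y) {B : ℝ} (hxB : ∀ i, (x i : ℝ) ≤ B) (hyB : ∀ i, (y i : ℝ) ≤ B) :
    0 < detXY x y ∧ detXY x y ≤ 4 * B ^ 2 := by
  have hB : 2 ≤ B := le_trans (by exact_mod_cast (hx 0).two_le) (hxB 0)
  by_cases h : 0 < pluckerSq (fun i => (x i : ℤ)) fun i => (y i : ℤ)
  · obtain ⟨z₀, w₀, hz₀, hw₀, h₀⟩ := exists_orthogonal_pair h
    refine ⟨one_pos.trans_le (one_le_latDet2 hz₀ hw₀ h₀), ?_⟩
    obtain ⟨z, hz, w, hw, hzw⟩ := (saturated_orthogonal _ _).exists_primPair hz₀ hw₀ h₀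
    refine (latDet2_le hz hw hzw.pos).trans ?_
    obtain ⟨t, ht⟩ := hzw.exists_pluckerSq_eq (z := fun i => (x i : ℤ)) (w := fun i => (y i : ℤ))
      (by simpa only [mul_comm] using hz.1) (by simpa only [mul_comm] using hz.2)
      (by simpa only [mul_comm] using hw.1) (by simpa only [mul_comm] using hw.2)
    have hpos := hzw.pos
    have ht0 : 0 < t ^ 2 := by
      rw [ht] at h
      exact pos_of_mul_pos_left h hpos.le
    have h1 : pluckerSq z w ≤ pluckerSq (fun i => (x i : ℤ)) fun i => (y i : ℤ) := by
      rw [ht]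
      nlinarith
    rw [Real.sqrt_le_left (by positivity)]
    calc (pluckerSq z w : ℝ) ≤ (pluckerSq (fun i => (x i : ℤ)) fun i => (y i : ℤ) : ℤ) := by
          exact_mod_cast h1
      _ ≤ (∑ i, (x i : ℝ) ^ 2) * ∑ i, (y i : ℝ) ^ 2 := by
        rw [pluckerSq_eq]
        push_cast
        nlinarith [sq_nonneg (∑ i, (x i : ℝ) * (y i : ℝ))]
      _ ≤ (∑ i : Fin 4, B ^ 2) * ∑ i : Fin 4, B ^ 2 := by
        gcongr with i _ i _
        · exact hxB i
        · exact hyB i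
      _ = _ := by simp; ring
  · obtain ⟨p, q, rfl, rfl⟩ := eq_const_of_pluckerSq_eq_zero hx hy hxy h
    have hz : (![1, -1, 0, 0] : Fin 4 → ℤ) ∈ {z : Fin 4 → ℤ |
        (∑ i, (p : ℤ) * z i) = 0 ∧ (∑ i, (q : ℤ) * z i) = 0} := by
      simp [Fin.sum_univ_four]
    have hw : (![0, 0, 1, -1] : Fin 4 → ℤ) ∈ {z : Fin 4 → ℤ |
        (∑ i, (p : ℤ) * z i) = 0 ∧ (∑ i, (q : ℤ) * z i) = 0} := by
      simp [Fin.sum_univ_four]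
    have hzw : pluckerSq ![1, -1, 0, 0] ![0, 0, 1, -1] = 4 := by decide
    refine ⟨one_pos.trans_le (one_le_latDet2 hz hw (by rw [hzw]; norm_num)), ?_⟩
    refine (latDet2_le hz hw (by rw [hzw]; norm_num)).trans ?_
    rw [hzw, Real.sqrt_le_left (by positivity)]
    push_cast
    have : 4 ≤ B ^ 2 := by nlinarith
    nlinarith

theorem sum_range_one_div_max_le (M : ℕ) :
    ∑ k ∈ range (M + 1), 1 / max 1 (k : ℝ) ≤ 2 + Real.log M := by
  have h := harmonic_le_one_add_log M
  rw [sum_range_succ']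
  have : ∑ k ∈ range M, 1 / max 1 ((k + 1 : ℕ) : ℝ) = ((harmonic M : ℚ) : ℝ) := by
    rw [harmonic]
    push_cast
    refine sum_congr rfl fun k _ => ?_
    rw [max_eq_right (by linarith [(Nat.cast_nonneg k : (0 : ℝ) ≤ k)]), one_div]
  rw [this]
  simp
  linarith

theorem sum_Icc_one_div_max_abs_le (M : ℕ) :
    ∑ n ∈ Icc (-(M : ℤ)) M, 1 / max 1 |(n : ℝ)| ≤ 4 + 2 * Real.log M := by
  have hsub : Icc (-(M : ℤ)) M ⊆ (range (M + 1)).image (fun k : ℕ => (k : ℤ)) ∪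
      (range (M + 1)).image (fun k : ℕ => -(k : ℤ)) := by
    intro n hn
    rw [mem_Icc] at hn
    simp only [mem_union, mem_image, mem_range]
    rcases le_total 0 n with h | h
    · exact Or.inl ⟨n.toNat, by omega, by omega⟩
    · exact Or.inr ⟨(-n).toNat, by omega, by omega⟩
  have hnn : ∀ n : ℤ, 0 ≤ 1 / max 1 |(n : ℝ)| := fun n => by positivity
  have h1 : ∑ n ∈ (range (M + 1)).image (fun k : ℕ => (k : ℤ)), 1 / max 1 |(n : ℝ)| =
      ∑ k ∈ range (M + 1), 1 / max 1 (k : ℝ) := by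
    rw [sum_image (by intro a _ b _ h; simpa using h)]
    simp
  have h2 : ∑ n ∈ (range (M + 1)).image (fun k : ℕ => -(k : ℤ)), 1 / max 1 |(n : ℝ)| =
      ∑ k ∈ range (M + 1), 1 / max 1 (k : ℝ) := by
    rw [sum_image (by intro a _ b _ h; simpa using h)]
    simp
  have h3 := sum_union_inter (s₁ := (range (M + 1)).image (fun k : ℕ => (k : ℤ)))
    (s₂ := (range (M + 1)).image (fun k : ℕ => -(k : ℤ))) (f := fun n : ℤ => 1 / max 1 |(n : ℝ)|)
  have h4 := sum_le_sum_of_subset_of_nonneg hsub fun n _ _ => hnn n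
  have h5 := sum_range_one_div_max_le M
  have h6 : 0 ≤ ∑ n ∈ (range (M + 1)).image (fun k : ℕ => (k : ℤ)) ∩
    (range (M + 1)).image (fun k : ℕ => -(k : ℤ)), 1 / max 1 |(n : ℝ)| :=
    sum_nonneg fun n _ => hnn n
  linarith

/-- The number of integers `a` with `a² n ≤ K` is at most `3 √(K / n)` if `n ≤ K`. -/
theorem card_sq_mul_le {K n : ℝ} (hn : 0 < n) (hnK : n ≤ K) (s : Finset ℤ)
    (hs : ∀ a ∈ s, (a : ℝ) ^ 2 * n ≤ K) : (s.card : ℝ) ≤ 3 * √(K / n) := by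
  have h1 : 1 ≤ √(K / n) := Real.one_le_sqrt.2 ((one_le_div hn).2 hnK)
  have hsub : s ⊆ Icc (-(⌊√(K / n)⌋₊ : ℤ)) ⌊√(K / n)⌋₊ := by
    intro a ha
    have h2 : |(a : ℝ)| ≤ √(K / n) := Real.abs_le_sqrt ((le_div_iff₀ hn).2 (hs a ha))
    have h3 : a.natAbs ≤ ⌊√(K / n)⌋₊ := Nat.le_floor (by rwa [Nat.cast_natAbs, Int.cast_abs])
    rw [mem_Icc]
    omega
  have h3 := card_le_card hsub
  rw [Int.card_Icc] at h3
  have h4 : s.card ≤ 2 * ⌊√(K / n)⌋₊ + 1 := by omega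
  have h5 : (s.card : ℝ) ≤ 2 * ⌊√(K / n)⌋₊ + 1 := by exact_mod_cast h4
  have h6 := Nat.floor_le (zero_le_one.trans h1)
  linarith

/-- The sum of `‖u‖⁻⁴` over nonzero integer quadruples in a box. -/
theorem sum_one_div_sq_sq_le (M : ℕ) (s : Finset (Fin 4 → ℤ))
    (hs : ∀ u ∈ s, 0 < ∑ i, u i ^ 2 ∧ ∀ i, |u i| ≤ M) :
    ∑ u ∈ s, 1 / ((∑ i, u i ^ 2 : ℤ) : ℝ) ^ 2 ≤ (4 + 2 * Real.log M) ^ 4 := by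
  have hsub : s ⊆ Fintype.piFinset fun _ : Fin 4 => Icc (-(M : ℤ)) M := fun u hu => by
    rw [Fintype.mem_piFinset]
    exact fun i => mem_Icc.2 (abs_le.1 ((hs u hu).2 i))
  calc ∑ u ∈ s, 1 / ((∑ i, u i ^ 2 : ℤ) : ℝ) ^ 2
      ≤ ∑ u ∈ s, ∏ i, 1 / max 1 |(u i : ℝ)| := by
        refine sum_le_sum fun u hu => ?_
        have hpos := (hs u hu).1
        have hle : ∀ i, max 1 |(u i : ℝ)| ≤ √((∑ i, u i ^ 2 : ℤ) : ℝ) := fun i => by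
          refine max_le (Real.one_le_sqrt.2 (by exact_mod_cast hpos)) (Real.abs_le_sqrt ?_)
          exact_mod_cast single_le_sum (f := fun i => u i ^ 2) (fun j _ => sq_nonneg (u j))
            (mem_univ i)
        rw [prod_div_distrib, prod_const_one]
        refine one_div_le_one_div_of_le (prod_pos fun i _ => by positivity) ?_
        refine (prod_le_prod (fun i _ => by positivity) fun i _ => hle i).trans_eq ?_
        rw [prod_const, card_univ, Fintype.card_fin]
        have : √((∑ i, u i ^ 2 : ℤ) : ℝ) ^ 2 = ((∑ i, u i ^ 2 : ℤ) : ℝ) :=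
          Real.sq_sqrt (by exact_mod_cast hpos.le)
        exact (pow_mul _ 2 2).trans (by rw [this])
    _ ≤ ∑ u ∈ Fintype.piFinset fun _ : Fin 4 => Icc (-(M : ℤ)) M, ∏ i, 1 / max 1 |(u i : ℝ)| :=
        sum_le_sum_of_subset_of_nonneg hsub fun u _ _ => prod_nonneg fun i _ => by positivity
    _ = (∑ n ∈ Icc (-(M : ℤ)) M, 1 / max 1 |(n : ℝ)|) ^ 4 := by
        rw [sum_prod_piFinset _ fun _ (n : ℤ) => 1 / max 1 |(n : ℝ)|, prod_const, card_univ,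
          Fintype.card_fin]
    _ ≤ (4 + 2 * Real.log M) ^ 4 :=
        pow_le_pow_left₀ (sum_nonneg fun n _ => by positivity) (sum_Icc_one_div_max_abs_le M) 4

theorem sum_triples_one_div_le {K : ℝ} {M : ℕ} (hK : 0 ≤ K) (hM : √K ≤ M) (T : Finset ((Fin 4 → ℤ) × ℤ × ℤ))
    (hT : ∀ t ∈ T, 0 < ∑ i, t.1 i ^ 2 ∧ ((∑ i, t.1 i ^ 2 : ℤ) : ℝ) ≤ K ∧
      (t.2.1 : ℝ) ^ 2 * (∑ i, t.1 i ^ 2 : ℤ) ≤ K ∧ (t.2.2 : ℝ) ^ 2 * (∑ i, t.1 i ^ 2 : ℤ) ≤ K) :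
    ∑ t ∈ T, 1 / ((∑ i, t.1 i ^ 2 : ℤ) : ℝ) ≤ 9 * K * (4 + 2 * Real.log M) ^ 4 := by
  have hsq : ∀ {n : ℤ}, (n : ℝ) ^ 2 ≤ K → |n| ≤ M := fun {n} hn => by
    have := (Real.abs_le_sqrt hn).trans hM
    exact_mod_cast this
  have hfib : ∀ u ∈ T.image Prod.fst, ∑ t ∈ T with t.1 = u, 1 / ((∑ i, t.1 i ^ 2 : ℤ) : ℝ) ≤
      9 * K * (1 / ((∑ i, u i ^ 2 : ℤ) : ℝ) ^ 2) := by
    intro u hu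
    obtain ⟨t, ht, rfl⟩ := mem_image.1 hu
    obtain ⟨h1, h2, -, -⟩ := hT t ht
    set n : ℤ := ∑ i, t.1 i ^ 2 with hn
    have hn0 : (0 : ℝ) < n := by exact_mod_cast h1
    set A : Finset ℤ := {a ∈ Icc (-(M : ℤ)) M | (a : ℝ) ^ 2 * n ≤ K} with hA
    have hmem : ∀ a : ℤ, (a : ℝ) ^ 2 * n ≤ K → a ∈ A := fun a ha => by
      rw [hA, mem_filter, mem_Icc]
      refine ⟨abs_le.1 (hsq (le_trans ?_ ha)), ha⟩
      exact le_mul_of_one_le_right (sq_nonneg _) (by exact_mod_cast h1)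
    have hsub : {s ∈ T | s.1 = t.1} ⊆ {t.1} ×ˢ A ×ˢ A := by
      intro s hs
      rw [mem_filter] at hs
      obtain ⟨-, -, h3, h4⟩ := hT s hs.1
      rw [hs.2] at h3 h4
      simp only [mem_product, mem_singleton]
      exact ⟨hs.2, hmem _ h3, hmem _ h4⟩
    have hcard := card_le_card hsub
    rw [card_product, card_product, card_singleton, one_mul] at hcard
    have hAcard := card_sq_mul_le hn0 h2 A fun a ha => (mem_filter.1 ha).2
    have hcard' : (({s ∈ T | s.1 = t.1}.card : ℕ) : ℝ) ≤ 9 * (K / n) := by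
      calc (({s ∈ T | s.1 = t.1}.card : ℕ) : ℝ) ≤ (A.card : ℝ) * A.card := by exact_mod_cast hcard
        _ ≤ (3 * √(K / n)) * (3 * √(K / n)) := by gcongr
        _ = 9 * √(K / n) ^ 2 := by ring
        _ = 9 * (K / n) := by rw [Real.sq_sqrt (by positivity)]
    calc ∑ s ∈ T with s.1 = t.1, 1 / ((∑ i, s.1 i ^ 2 : ℤ) : ℝ)
        = ∑ s ∈ T with s.1 = t.1, 1 / (n : ℝ) :=
          sum_congr rfl fun s hs => by rw [(mem_filter.1 hs).2]
      _ = ({s ∈ T | s.1 = t.1}.card : ℕ) * (1 / (n : ℝ)) := by rw [sum_const, nsmul_eq_mul]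
      _ ≤ 9 * (K / n) * (1 / n) := by gcongr
      _ = 9 * K * (1 / (n : ℝ) ^ 2) := by field_simp
  rw [← sum_fiberwise_of_maps_to (s := T) (t := T.image Prod.fst) (g := Prod.fst)
    fun t ht => mem_image_of_mem _ ht]
  refine (sum_le_sum hfib).trans ?_
  rw [← mul_sum]
  refine mul_le_mul_of_nonneg_left (sum_one_div_sq_sq_le M _ fun u hu => ?_) (by positivity)
  obtain ⟨t, ht, rfl⟩ := mem_image.1 hu
  obtain ⟨h1, h2, -, -⟩ := hT t ht
  refine ⟨h1, fun i => hsq (le_trans ?_ h2)⟩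
  exact_mod_cast single_le_sum (f := fun i => t.1 i ^ 2) (fun j _ => sq_nonneg (t.1 j)) (mem_univ i)

/-- Size constraints on a reduced basis `u, v` and on the coefficients of `x, y` in it. -/
theorem reduced_decomposition_bounds {x y : Fin 4 → ℕ} {B D : ℝ} (hxB : ∀ i, (x i : ℝ) ≤ B)
    (hyB : ∀ i, (y i : ℝ) ≤ B) (hD : 0 < D) {u v : Fin 4 → ℤ} {a b c e : ℤ}
    (hx : (fun i => (x i : ℤ)) = a • u + b • v) (hy : (fun i => (y i : ℤ)) = c • u + e • v)
    (huv : PrimPair u v) (hred : 3 * ((∑ i, u i ^ 2) * ∑ i, v i ^ 2) ≤ 4 * pluckerSq u v)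
    (hdet : D ≤ |(a * e - b * c : ℤ)|) :
    (0 < ∑ i, u i ^ 2 ∧ ((∑ i, u i ^ 2 : ℤ) : ℝ) ≤ 6 * B ^ 2 ∧
      (a : ℝ) ^ 2 * (∑ i, u i ^ 2 : ℤ) ≤ 6 * B ^ 2 ∧
      (c : ℝ) ^ 2 * (∑ i, u i ^ 2 : ℤ) ≤ 6 * B ^ 2) ∧
    (0 < ∑ i, v i ^ 2 ∧ ((∑ i, v i ^ 2 : ℤ) : ℝ) ≤ 6 * B ^ 2 ∧
      (b : ℝ) ^ 2 * (∑ i, v i ^ 2 : ℤ) ≤ 6 * B ^ 2 ∧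
      (e : ℝ) ^ 2 * (∑ i, v i ^ 2 : ℤ) ≤ 6 * B ^ 2) ∧
    1 / √(pluckerSq u v : ℝ) ≤
      6 * B ^ 2 / D * (1 / (∑ i, u i ^ 2 : ℤ) * (1 / (∑ i, v i ^ 2 : ℤ))) := by
  have hP := huv.pos
  have hpl := pluckerSq_eq u v
  set n : ℤ := ∑ i, u i ^ 2 with hn
  set m : ℤ := ∑ i, v i ^ 2 with hm
  have hn0 : 0 ≤ n := sum_nonneg fun i _ => sq_nonneg (u i)
  have hm0 : 0 ≤ m := sum_nonneg fun i _ => sq_nonneg (v i)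
  have hnm : 0 < n * m := by nlinarith [sq_nonneg (∑ i, u i * v i)]
  have hn1 : 0 < n := pos_of_mul_pos_left hnm hm0
  have hm1 : 0 < m := pos_of_mul_pos_right hnm hn0
  have hn1' : (0 : ℝ) < n := by exact_mod_cast hn1
  have hm1' : (0 : ℝ) < m := by exact_mod_cast hm1
  have hred' : 3 * ((n : ℝ) * m) ≤ 4 * pluckerSq u v := by exact_mod_cast hred
  have hnorm : ∀ z : Fin 4 → ℕ, (∀ i, (z i : ℝ) ≤ B) →
      ((∑ i, (z i : ℤ) ^ 2 : ℤ) : ℝ) ≤ 4 * B ^ 2 := by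
    intro z hz
    have : ∀ i, (z i : ℝ) ^ 2 ≤ B ^ 2 := fun i => pow_le_pow_left₀ (Nat.cast_nonneg _) (hz i) 2
    push_cast
    rw [Fin.sum_univ_four]
    linarith [this 0, this 1, this 2, this 3]
  have hle : ∀ z w : Fin 4 → ℤ, (pluckerSq z w : ℝ) ≤
      (∑ i, z i ^ 2 : ℤ) * (∑ i, w i ^ 2 : ℤ) := fun z w => by
    have := pluckerSq_eq z w
    have h2 : pluckerSq z w ≤ (∑ i, z i ^ 2) * (∑ i, w i ^ 2) := by
      nlinarith [sq_nonneg (∑ i, z i * w i)]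
    exact_mod_cast h2
  have hcoef : ∀ (z : Fin 4 → ℕ) (r s : ℤ), (∀ i, (z i : ℝ) ≤ B) →
      (fun i => (z i : ℤ)) = r • u + s • v → (r : ℝ) ^ 2 * n ≤ 6 * B ^ 2 ∧
      (s : ℝ) ^ 2 * m ≤ 6 * B ^ 2 := by
    intro z r s hzB hz
    have hz1 := hnorm z hzB
    have h1 := pluckerSq_combination (k := 1) (l := 1) (z := fun i => (z i : ℤ)) (w := v)
      (u := u) (v := v) (a := r) (b := s) (c := 0) (e := 1) (by simpa using hz) (by simp)
    have h2 := pluckerSq_combination (k := 1) (l := 1) (z := u) (w := fun i => (z i : ℤ))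
      (u := u) (v := v) (a := 1) (b := 0) (c := r) (e := s) (by simp) (by simpa using hz)
    have h3 := hle (fun i => (z i : ℤ)) v
    have h4 := hle u (fun i => (z i : ℤ))
    simp only [one_pow, mul_one, one_mul, mul_zero, zero_mul, sub_zero] at h1 h2
    rw [h1, Int.cast_mul, Int.cast_pow] at h3
    rw [h2, Int.cast_mul, Int.cast_pow] at h4
    have hB : 0 ≤ B ^ 2 := sq_nonneg B
    constructor
    · refine le_of_mul_le_mul_right ?_ hm1'
      have h5 := mul_le_mul_of_nonneg_left hred' (sq_nonneg (r : ℝ))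
      have h6 := mul_le_mul_of_nonneg_right hz1 hm1'.le
      have h7 := mul_nonneg hB hm1'.le
      linarith
    · refine le_of_mul_le_mul_right ?_ hn1'
      have h5 := mul_le_mul_of_nonneg_left hred' (sq_nonneg (s : ℝ))
      have h6 := mul_le_mul_of_nonneg_right hz1 hn1'.le
      have h7 := mul_nonneg hB hn1'.le
      linarith
  obtain ⟨ha, hb⟩ := hcoef x a b hxB hx
  obtain ⟨hc, he⟩ := hcoef y c e hyB hy
  have hdet0 : a * e - b * c ≠ 0 := by
    intro h
    rw [h] at hdet
    simp only [abs_zero, Int.cast_zero] at hdet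
    linarith
  have hone : ∀ {r : ℤ}, r ≠ 0 → (1 : ℝ) ≤ (r : ℝ) ^ 2 := fun {r} hr => by
    exact_mod_cast Int.add_one_le_iff.2 (sq_pos_of_ne_zero hr)
  have hn6 : (n : ℝ) ≤ 6 * B ^ 2 := by
    by_cases h : a = 0
    · have : c ≠ 0 := by rintro rfl; simp [h] at hdet0
      exact (le_mul_of_one_le_left hn1'.le (hone this)).trans hc
    · exact (le_mul_of_one_le_left hn1'.le (hone h)).trans ha
  have hm6 : (m : ℝ) ≤ 6 * B ^ 2 := by
    by_cases h : b = 0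
    · have : e ≠ 0 := by rintro rfl; simp [h] at hdet0
      exact (le_mul_of_one_le_left hm1'.le (hone this)).trans he
    · exact (le_mul_of_one_le_left hm1'.le (hone h)).trans hb
  refine ⟨⟨hn1, hn6, ha, hc⟩, ⟨hm1, hm6, hb, he⟩, ?_⟩
  have hP' : (0 : ℝ) < pluckerSq u v := by exact_mod_cast hP
  have hs := Real.sqrt_pos.2 hP'
  have hss := Real.mul_self_sqrt hP'.le
  have h1 := pluckerSq_combination (k := 1) (l := 1) (z := fun i => (x i : ℤ))
    (w := fun i => (y i : ℤ)) (u := u) (v := v) (a := a) (b := b) (c := c) (e := e)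
    (by simpa using hx) (by simpa using hy)
  have h2 := hle (fun i => (x i : ℤ)) (fun i => (y i : ℤ))
  simp only [one_pow, mul_one, one_mul] at h1
  rw [h1, Int.cast_mul, Int.cast_pow] at h2
  have h3 : D * √(pluckerSq u v : ℝ) ≤ 4 * B ^ 2 := by
    refine abs_le_of_sq_le_sq' (a := D * √(pluckerSq u v : ℝ)) ?_ (by positivity) |>.2
    rw [mul_pow, Real.sq_sqrt hP'.le]
    have h4 : D ^ 2 ≤ ((a * e - b * c : ℤ) : ℝ) ^ 2 := by
      rw [← sq_abs ((a * e - b * c : ℤ) : ℝ), ← Int.cast_abs]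
      exact pow_le_pow_left₀ hD.le hdet 2
    have h5 := mul_le_mul_of_nonneg_right h4 hP'.le
    have h6 := mul_le_mul (hnorm x hxB) (hnorm y hyB)
      (by exact_mod_cast sum_nonneg fun i _ => sq_nonneg (y i : ℤ)) (by positivity)
    calc _ ≤ _ := h5
      _ ≤ _ := h2
      _ ≤ _ := h6
      _ = _ := by ring
  rw [div_mul_div_comm, one_mul, div_mul_div_comm, mul_one, div_le_div_iff₀ hs (by positivity),
    one_mul]
  calc D * (n * m) ≤ D * (4 / 3 * (√(pluckerSq u v : ℝ) * √(pluckerSq u v : ℝ))) := by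
        refine mul_le_mul_of_nonneg_left ?_ hD.le
        rw [hss]
        linarith
    _ = 4 / 3 * (D * √(pluckerSq u v : ℝ)) * √(pluckerSq u v : ℝ) := by ring
    _ ≤ 4 / 3 * (4 * B ^ 2) * √(pluckerSq u v : ℝ) := by gcongr
    _ ≤ 6 * B ^ 2 * √(pluckerSq u v : ℝ) := by
        refine mul_le_mul_of_nonneg_right ?_ hs.le
        linarith [sq_nonneg B]

/-- The contribution of the pairs spanning a sublattice of large index in its saturation. -/
theorem sum_large_index_le : ∃ C > (0 : ℝ), ∀ (B D : ℝ) (S : Finset ((Fin 4 → ℕ) × (Fin 4 → ℕ))),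
    3 ≤ B → 0 < D →
    (∀ p ∈ S, (∀ i, (p.1 i : ℝ) ≤ B) ∧ (∀ i, (p.2 i : ℝ) ≤ B) ∧
      ∃ u v : Fin 4 → ℤ, ∃ a b c e : ℤ, (fun i => (p.1 i : ℤ)) = a • u + b • v ∧
        (fun i => (p.2 i : ℤ)) = c • u + e • v ∧ PrimPair u v ∧
        u ∈ satSpan (fun i => (p.1 i : ℤ)) (fun i => (p.2 i : ℤ)) ∧
        v ∈ satSpan (fun i => (p.1 i : ℤ)) (fun i => (p.2 i : ℤ)) ∧
        3 * ((∑ i, u i ^ 2) * ∑ i, v i ^ 2) ≤ 4 * pluckerSq u v ∧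
        D ≤ |(a * e - b * c : ℤ)|) →
    ∑ p ∈ S, 1 / detXY p.1 p.2 ≤ C * B ^ 6 * Real.log B ^ 8 / D := by
  refine ⟨6 * (54 * 8 ^ 4) ^ 2, by positivity, fun B D S hB hD hS => ?_⟩
  have h1 := fun p hp => (hS p hp).1
  have h2 := fun p hp => (hS p hp).2.1
  have h3 := fun p hp => (hS p hp).2.2
  choose! u v a b c e hx hy huv hu hv hred hdet using h3
  have hbd := fun p hp => reduced_decomposition_bounds (h1 p hp) (h2 p hp) hD (hx p hp) (hy p hp)
    (huv p hp) (hred p hp) (hdet p hp)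
  set g : (Fin 4 → ℕ) × (Fin 4 → ℕ) → ((Fin 4 → ℤ) × ℤ × ℤ) × ((Fin 4 → ℤ) × ℤ × ℤ) :=
    fun p => ((u p, a p, c p), (v p, b p, e p)) with hg
  have hinj : Set.InjOn g S := by
    intro p hp q hq hpq
    simp only [hg, Prod.mk.injEq] at hpq
    obtain ⟨⟨e1, e2, e3⟩, e4, e5, e6⟩ := hpq
    have hx1 := hx p hp
    have hy1 := hy p hp
    rw [e1, e2, e4, e5, ← hx q hq] at hx1
    rw [e1, e3, e4, e6, ← hy q hq] at hy1
    refine Prod.ext (funext fun i => ?_) (funext fun i => ?_)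
    · exact_mod_cast congrFun hx1 i
    · exact_mod_cast congrFun hy1 i
  set w : (Fin 4 → ℤ) × ℤ × ℤ → ℝ := fun t => 1 / ((∑ i, t.1 i ^ 2 : ℤ) : ℝ) with hw
  have hw0 : ∀ t, 0 ≤ w t := fun t => by
    have : (0 : ℤ) ≤ ∑ i, t.1 i ^ 2 := sum_nonneg fun i _ => sq_nonneg (t.1 i)
    have : (0 : ℝ) ≤ (∑ i, t.1 i ^ 2 : ℤ) := by exact_mod_cast this
    exact one_div_nonneg.2 this
  set T := (S.image g).image Prod.fst ∪ (S.image g).image Prod.snd with hT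
  set M := ⌊3 * B⌋₊ with hM
  have hL : 1 ≤ Real.log B := by
    rw [Real.le_log_iff_exp_le (by linarith)]
    linarith [Real.exp_one_lt_three]
  have hMlog : 4 + 2 * Real.log M ≤ 8 * Real.log B := by
    have h4 : Real.log M ≤ Real.log (B ^ 2) := by
      refine Real.log_le_log ?_ ((Nat.floor_le (by linarith)).trans (by nlinarith))
      exact_mod_cast Nat.floor_pos.2 (by linarith)
    rw [Real.log_pow] at h4
    push_cast at h4
    linarith
  have hM0 : 0 ≤ Real.log M := Real.log_natCast_nonneg M
  have hMK : √(6 * B ^ 2) ≤ M := by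
    have h4 : √(6 * B ^ 2) ≤ 5 / 2 * B := Real.sqrt_le_iff.2 ⟨by positivity, by nlinarith⟩
    linarith [Nat.sub_one_lt_floor (3 * B)]
  have hTsum : ∑ t ∈ T, w t ≤ 54 * 8 ^ 4 * B ^ 2 * Real.log B ^ 4 := by
    refine (sum_triples_one_div_le (K := 6 * B ^ 2) (by positivity) hMK T ?_).trans ?_
    · intro t ht
      rw [hT, mem_union, mem_image, mem_image] at ht
      rcases ht with ⟨_, hs, rfl⟩ | ⟨_, hs, rfl⟩ <;> obtain ⟨p, hp, rfl⟩ := mem_image.1 hs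
      · exact (hbd p hp).1
      · exact (hbd p hp).2.1
    · calc 9 * (6 * B ^ 2) * (4 + 2 * Real.log M) ^ 4
          ≤ 9 * (6 * B ^ 2) * (8 * Real.log B) ^ 4 := by gcongr
        _ = _ := by ring
  calc ∑ p ∈ S, 1 / detXY p.1 p.2
      ≤ ∑ p ∈ S, 6 * B ^ 2 / D * (w (g p).1 * w (g p).2) := sum_le_sum fun p hp =>
        (one_div_detXY_le (huv p hp) (hu p hp) (hv p hp)).trans (hbd p hp).2.2
    _ = ∑ q ∈ S.image g, 6 * B ^ 2 / D * (w q.1 * w q.2) := by rw [sum_image hinj]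
    _ ≤ ∑ q ∈ T ×ˢ T, 6 * B ^ 2 / D * (w q.1 * w q.2) := by
        refine sum_le_sum_of_subset_of_nonneg (fun q hq => ?_) fun q _ _ => ?_
        · rw [mem_product, hT, mem_union, mem_union]
          exact ⟨Or.inl (mem_image_of_mem _ hq), Or.inr (mem_image_of_mem _ hq)⟩
        · have := hw0 q.1
          have := hw0 q.2
          positivity
    _ = 6 * B ^ 2 / D * (∑ t ∈ T, w t) ^ 2 := by
        rw [← mul_sum, sq (∑ t ∈ T, w t), sum_mul_sum, sum_product]
    _ ≤ 6 * B ^ 2 / D * (54 * 8 ^ 4 * B ^ 2 * Real.log B ^ 4) ^ 2 := by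
        have := sum_nonneg fun t (_ : t ∈ T) => hw0 t
        gcongr
    _ = 6 * (54 * 8 ^ 4) ^ 2 * B ^ 6 * Real.log B ^ 8 / D := by ring

theorem max_one_rpow_cube_le (z : ℝ) :
    ((max 1 z) ^ (5 / 6 : ℝ)) ^ 3 ≤ 1 + z ^ 2 * √z := by
  have h1 : ((max 1 z) ^ (5 / 6 : ℝ)) ^ 3 = (max 1 z) ^ 2 * √(max 1 z) := by
    have h0 : 0 < max 1 z := lt_max_of_lt_left one_pos
    rw [← Real.rpow_natCast, ← Real.rpow_mul h0.le, Real.sqrt_eq_rpow, ← Real.rpow_natCast,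
      ← Real.rpow_add h0]
    norm_num
  rw [h1]
  rcases le_total z 1 with h | h
  · rw [max_eq_left h]
    simp only [one_pow, Real.sqrt_one, mul_one]
    have : 0 ≤ z ^ 2 * √z := by positivity
    linarith
  · rw [max_eq_right h]
    linarith

/-- Quadruples of primes with one prescribed coordinate whose minors with a given quadruple
are divisible by `d` and bounded by `R`. -/
theorem card_prime_quadruples_le : ∃ C > (0 : ℝ), ∀ (B R : ℝ) (d q : ℕ) (i : Fin 4)
    (x : Fin 4 → ℕ) (S : Finset (Fin 4 → ℕ)), 3 ≤ B → 0 < d → 0 ≤ R → 0 < x i →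
    d.Coprime (x i) → (∀ y ∈ S, y i = q) → (∀ y ∈ S, ∀ j, (y j).Prime ∧ (y j : ℝ) ≤ B) →
    (∀ y ∈ S, ∀ j, (d : ℤ) ∣ x i * y j - x j * y i) →
    (∀ y ∈ S, ∀ j, |((x i * y j - x j * y i : ℤ) : ℝ)| ≤ R) →
    (S.card : ℝ) ≤ C * (1 + (2 * R / (x i * d)) ^ 2 * √(2 * R / (x i * d))) *
      (√B / Real.log B ^ 3) := by
  obtain ⟨C, hC, h⟩ := card_prime_modEq_le
  refine ⟨C ^ 3, by positivity, fun B R d q i x S hB hd hR hx hcop hq hS hdvd habs => ?_⟩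
  have hB0 : 0 < B := by linarith
  have hL : 0 < Real.log B := Real.log_pos (by linarith)
  have hx' : (0 : ℝ) < x i := by exact_mod_cast hx
  have hd' : (0 : ℝ) < d := by exact_mod_cast hd
  set z := 2 * R / (x i * d) with hz
  have hz0 : 0 ≤ z := by positivity
  set t : Fin 4 → Finset ℕ := fun j => S.image fun y => y j with ht
  have hsub : S ⊆ Fintype.piFinset t := fun y hy =>
    Fintype.mem_piFinset.2 fun j => mem_image_of_mem _ hy
  have hti : (t i).card ≤ 1 := by
    rw [card_le_one]
    intro a ha b hb
    obtain ⟨y, hy, rfl⟩ := mem_image.1 ha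
    obtain ⟨y', hy', rfl⟩ := mem_image.1 hb
    rw [hq y hy, hq y' hy']
  have htj : ∀ j, ((t j).card : ℝ) ≤
      C * (max 1 z) ^ (5 / 6 : ℝ) * B ^ (1 / 6 : ℝ) / Real.log B := by
    intro j
    have := h B (2 * R / x i) d (t j) hB hd ?_ ?_ ?_
    · rwa [div_div] at this
    · intro p hp
      obtain ⟨y, hy, rfl⟩ := mem_image.1 hp
      exact hS y hy j
    · intro p hp p' hp'
      obtain ⟨y, hy, rfl⟩ := mem_image.1 hp
      obtain ⟨y', hy', rfl⟩ := mem_image.1 hp'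
      have h1 := dvd_sub (hdvd y' hy' j) (hdvd y hy j)
      rw [hq y hy, hq y' hy'] at h1
      rw [show (x i * y' j - x j * q - (x i * y j - x j * q) : ℤ) = x i * (y' j - y j) by ring]
        at h1
      exact Nat.modEq_iff_dvd.2 (IsCoprime.dvd_of_dvd_mul_left
        (Nat.isCoprime_iff_coprime.2 hcop) h1)
    · intro p hp p' hp'
      obtain ⟨y, hy, rfl⟩ := mem_image.1 hp
      obtain ⟨y', hy', rfl⟩ := mem_image.1 hp'
      have h1 := abs_le.1 (habs y hy j)
      have h2 := abs_le.1 (habs y' hy' j)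
      rw [hq y hy] at h1
      rw [hq y' hy'] at h2
      push_cast at h1 h2
      rw [le_div_iff₀ hx']
      linarith [h1.1, h2.2]
  have hcard := card_le_card hsub
  rw [Fintype.card_piFinset, ← mul_prod_erase univ _ (mem_univ i)] at hcard
  have hprod : (∏ j ∈ univ.erase i, ((t j).card : ℝ)) ≤
      (C * (max 1 z) ^ (5 / 6 : ℝ) * B ^ (1 / 6 : ℝ) / Real.log B) ^ 3 := by
    refine (prod_le_prod (fun j _ => Nat.cast_nonneg _) fun j _ => htj j).trans_eq ?_
    rw [prod_const, card_erase_of_mem (mem_univ i), card_univ, Fintype.card_fin]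
  have hB3 : (B ^ (1 / 6 : ℝ)) ^ 3 = √B := by
    rw [← Real.rpow_natCast, ← Real.rpow_mul hB0.le, Real.sqrt_eq_rpow]
    norm_num
  calc (S.card : ℝ) ≤ (t i).card * ∏ j ∈ univ.erase i, ((t j).card : ℝ) := by
        exact_mod_cast hcard
    _ ≤ 1 * ∏ j ∈ univ.erase i, ((t j).card : ℝ) := by
        refine mul_le_mul_of_nonneg_right (by exact_mod_cast hti)
          (prod_nonneg fun j _ => Nat.cast_nonneg _)
    _ ≤ (C * (max 1 z) ^ (5 / 6 : ℝ) * B ^ (1 / 6 : ℝ) / Real.log B) ^ 3 := by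
        rw [one_mul]
        exact hprod
    _ = C ^ 3 * ((max 1 z) ^ (5 / 6 : ℝ)) ^ 3 * (√B / Real.log B ^ 3) := by
        rw [← hB3]
        ring
    _ ≤ _ := by
        gcongr
        exact max_one_rpow_cube_le z

theorem exists_sum_one_div_mul_sqrt_le : ∃ C > (0 : ℝ), ∀ D : ℕ,
    ∑ d ∈ Icc 1 D, 1 / ((d : ℝ) * √d) ≤ C := by
  have hs : Summable fun n : ℕ => 1 / (n : ℝ) ^ (3 / 2 : ℝ) :=
    Real.summable_one_div_nat_rpow.2 (by norm_num)
  refine ⟨1 + ∑' n : ℕ, 1 / (n : ℝ) ^ (3 / 2 : ℝ), ?_, fun D => ?_⟩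
  · have : 0 ≤ ∑' n : ℕ, 1 / (n : ℝ) ^ (3 / 2 : ℝ) := tsum_nonneg fun n => by positivity
    linarith
  · have h1 : ∑ d ∈ Icc 1 D, 1 / ((d : ℝ) * √d) = ∑ d ∈ Icc 1 D, 1 / (d : ℝ) ^ (3 / 2 : ℝ) := by
      refine sum_congr rfl fun d hd => ?_
      have hd0 : (0 : ℝ) < d := by exact_mod_cast (mem_Icc.1 hd).1
      rw [Real.sqrt_eq_rpow, show (3 / 2 : ℝ) = 1 + 1 / 2 by norm_num, Real.rpow_add hd0,
        Real.rpow_one]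
    rw [h1]
    linarith [hs.sum_le_tsum (Icc 1 D) fun n _ => by positivity]

theorem sum_geometric_weights_le {X : ℝ} (hX : 0 < X) {d : ℝ} (hd : 0 < d) (K : ℕ)
    (hK : (2 : ℝ) ^ K ≤ 2 * X) :
    ∑ k ∈ range K, (1 + (2 * 4 ^ (k + 1) / (X * d)) ^ 2 * √(2 * 4 ^ (k + 1) / (X * d))) *
      (d / 4 ^ k) ≤ 2 * d + 192 * 8 * √X * (1 / (d * √d)) := by
  have hterm : ∀ k : ℕ,
      (1 + (2 * 4 ^ (k + 1) / (X * d)) ^ 2 * √(2 * 4 ^ (k + 1) / (X * d))) * (d / 4 ^ k) ≤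
      d * (1 / 4) ^ k + 192 / (X ^ 2 * √X * (d * √d)) * 8 ^ k := by
    intro k
    have h1 : √(2 * 4 ^ (k + 1) / (X * d)) ≤ 3 * 2 ^ k / (√X * √d) := by
      refine Real.sqrt_le_iff.2 ⟨by positivity, ?_⟩
      rw [div_pow, mul_pow, mul_pow, Real.sq_sqrt hX.le, Real.sq_sqrt hd.le, ← pow_mul,
        mul_comm k 2, pow_mul, pow_succ, show (2 : ℝ) ^ 2 = 4 by norm_num]
      refine div_le_div_of_nonneg_right ?_ (by positivity)
      linarith [pow_pos (four_pos : (0 : ℝ) < 4) k]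
    calc (1 + (2 * 4 ^ (k + 1) / (X * d)) ^ 2 * √(2 * 4 ^ (k + 1) / (X * d))) * (d / 4 ^ k)
        ≤ (1 + (2 * 4 ^ (k + 1) / (X * d)) ^ 2 * (3 * 2 ^ k / (√X * √d))) * (d / 4 ^ k) := by
          gcongr
      _ = d * (1 / 4) ^ k + 192 / (X ^ 2 * √X * (d * √d)) * 8 ^ k := by
          have e1 : (1 / 4 : ℝ) ^ k = 1 / 4 ^ k := by rw [div_pow, one_pow]
          have e2 : (8 : ℝ) ^ k = 2 ^ k * 4 ^ k := by rw [← mul_pow]; norm_num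
          rw [e1, e2]
          field_simp
          ring
  have hgeo : ∑ k ∈ range K, (1 / 4 : ℝ) ^ k ≤ 2 := by
    rw [geom_sum_eq (by norm_num)]
    have h1 : 0 < (1 / 4 : ℝ) ^ K := by positivity
    have h2 : ((1 / 4 : ℝ) ^ K - 1) / (1 / 4 - 1) = 4 / 3 * (1 - (1 / 4) ^ K) := by ring
    linarith
  have hgeo8 : ∑ k ∈ range K, (8 : ℝ) ^ k ≤ 8 * X ^ 3 := by
    rw [geom_sum_eq (by norm_num)]
    have h1 : (8 : ℝ) ^ K = (2 ^ K) ^ 3 := by rw [← pow_mul, mul_comm, pow_mul]; norm_num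
    have h2 : ((2 : ℝ) ^ K) ^ 3 ≤ (2 * X) ^ 3 := by gcongr
    have h3 : 0 < X ^ 3 := by positivity
    rw [h1]
    have h4 : (2 * X) ^ 3 = 8 * X ^ 3 := by ring
    linarith
  refine (sum_le_sum fun k _ => hterm k).trans ?_
  rw [sum_add_distrib, ← mul_sum, ← mul_sum]
  refine add_le_add (by nlinarith) ?_
  calc 192 / (X ^ 2 * √X * (d * √d)) * ∑ k ∈ range K, (8 : ℝ) ^ k
      ≤ 192 / (X ^ 2 * √X * (d * √d)) * (8 * X ^ 3) := by gcongr
    _ = 192 * 8 * √X * (1 / (d * √d)) := by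
        have h1 : X = √X * √X := (Real.mul_self_sqrt hX.le).symm
        have h2 : 0 < √X := Real.sqrt_pos.2 hX
        rw [div_mul_eq_mul_div, mul_one_div, div_eq_div_iff (by positivity) (by positivity)]
        linear_combination (192 * 8 * X ^ 2 * d * √d) * h1

/-- Linearly independent quadruples spanning a sublattice whose index in its saturation is
at most `D`. -/
def SmallIndex (D : ℕ) (x y : Fin 4 → ℕ) : Prop :=
  0 < pluckerSq (fun i => (x i : ℤ)) (fun i => (y i : ℤ)) ∧
    ∃ d : ℕ, 0 < d ∧ d ≤ D ∧ (∀ i j, (d : ℤ) ∣ x i * y j - x j * y i) ∧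
      1 / detXY x y ≤ d / √(pluckerSq (fun i => (x i : ℤ)) (fun i => (y i : ℤ)) : ℝ)

theorem sq_minor_le_pluckerSq (u v : Fin 4 → ℤ) (i j : Fin 4) :
    (u i * v j - u j * v i) ^ 2 ≤ pluckerSq u v := by
  simp only [pluckerSq, plucker, Fin.sum_univ_six]
  fin_cases i <;> fin_cases j <;> simp <;>
  nlinarith [sq_nonneg (u 0 * v 1 - u 1 * v 0), sq_nonneg (u 0 * v 2 - u 2 * v 0),
    sq_nonneg (u 0 * v 3 - u 3 * v 0), sq_nonneg (u 1 * v 2 - u 2 * v 1),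
    sq_nonneg (u 1 * v 3 - u 3 * v 1), sq_nonneg (u 2 * v 3 - u 3 * v 2)]

/-- If `x i` is positive, then some minor of `x, y` involving the `i`-th column is nonzero. -/
theorem exists_minor_ne_zero {x y : Fin 4 → ℤ} (h : 0 < pluckerSq x y) {i : Fin 4}
    (hi : x i ≠ 0) : ∃ j, x i * y j - x j * y i ≠ 0 := by
  by_contra! h0
  obtain ⟨j, k, hjk⟩ := (pluckerSq_pos_iff' x y).1 h
  refine hjk (mul_left_cancel₀ hi ?_)
  linear_combination x j * h0 k - x k * h0 j

/-- The dyadic scale of the minors of `x, y` involving the `i`-th column. -/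
theorem exists_scale {x y : Fin 4 → ℕ}
    (h : 0 < pluckerSq (fun i => (x i : ℤ)) (fun i => (y i : ℤ))) {i : Fin 4} (hi : 0 < x i)
    (hx : ∀ j, x j ≤ x i) (hy : ∀ j, y j ≤ x i) :
    ∃ k : ℕ, k < Nat.log 2 (x i) + 1 ∧
      (∀ j, |((x i * y j - x j * y i : ℤ) : ℝ)| ≤ 4 ^ (k + 1)) ∧
      (4 : ℝ) ^ k ≤ √(pluckerSq (fun i => (x i : ℤ)) (fun i => (y i : ℤ)) : ℝ) := by
  set m : Fin 4 → ℕ := fun j => (x i * y j - x j * y i : ℤ).natAbs with hm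
  obtain ⟨j₀, -, hj₀⟩ := exists_max_image univ m univ_nonempty
  obtain ⟨j₁, hj₁⟩ := exists_minor_ne_zero h (i := i) (by exact_mod_cast hi.ne')
  have hpos : m j₀ ≠ 0 := by
    have h1 : 0 < m j₁ := Int.natAbs_pos.2 hj₁
    have := hj₀ j₁ (mem_univ _)
    omega
  have hle : m j₀ ≤ x i ^ 2 := by
    have h1 : (x i * y j₀ : ℤ) ≤ x i ^ 2 := by
      rw [sq]; exact_mod_cast Nat.mul_le_mul_left _ (hy j₀)
    have h2 : (x j₀ * y i : ℤ) ≤ x i ^ 2 := by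
      rw [sq]; exact_mod_cast Nat.mul_le_mul (hx j₀) (hy i)
    have h3 : (0 : ℤ) ≤ x i * y j₀ := by positivity
    have h4 : (0 : ℤ) ≤ x j₀ * y i := by positivity
    have h5 : |(x i * y j₀ - x j₀ * y i : ℤ)| ≤ x i ^ 2 := abs_le.2 ⟨by linarith, by linarith⟩
    zify [hm]
    exact h5
  refine ⟨Nat.log 4 (m j₀), Nat.lt_succ_of_le ?_, fun j => ?_, ?_⟩
  · refine Nat.le_log_of_pow_le one_lt_two ?_
    have h1 := (Nat.pow_log_le_self 4 hpos).trans hle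
    rw [show 4 = 2 ^ 2 from rfl, ← pow_mul, mul_comm, pow_mul] at h1
    exact (Nat.pow_le_pow_iff_left two_ne_zero).1 h1
  · have h1 : m j < 4 ^ (Nat.log 4 (m j₀) + 1) :=
      (hj₀ j (mem_univ _)).trans_lt (Nat.lt_pow_succ_log_self (by norm_num) _)
    have h2 : ((m j : ℕ) : ℝ) ≤ 4 ^ (Nat.log 4 (m j₀) + 1) := by exact_mod_cast h1.le
    rwa [← Int.cast_abs, Int.abs_eq_natAbs, Int.cast_natCast]
  · have h1 := Nat.pow_log_le_self 4 hpos
    have h2 := sq_minor_le_pluckerSq (fun i => (x i : ℤ)) (fun i => (y i : ℤ)) i j₀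
    refine Real.le_sqrt_of_sq_le ?_
    have h3 : ((4 : ℝ) ^ Nat.log 4 (m j₀)) ^ 2 ≤ (m j₀ : ℝ) ^ 2 := by
      gcongr
      exact_mod_cast h1
    refine h3.trans ?_
    have h4 : ((m j₀ : ℤ)) ^ 2 ≤ pluckerSq (fun i => (x i : ℤ)) (fun i => (y i : ℤ)) := by
      rwa [Int.natAbs_sq]
    exact_mod_cast h4

theorem sum_small_index_fiber_le : ∃ C > (0 : ℝ), ∀ (B : ℝ) (D q : ℕ) (i : Fin 4)
    (x : Fin 4 → ℕ) (S : Finset (Fin 4 → ℕ)), 3 ≤ B → (x i).Prime → D < x i → (x i : ℝ) ≤ B →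
    (∀ j, x j ≤ x i) →
    (∀ y ∈ S, y i = q ∧ (∀ j, (y j).Prime ∧ y j ≤ x i) ∧ SmallIndex D x y) →
    ∑ y ∈ S, 1 / detXY x y ≤ C * (√B / Real.log B ^ 3) * (D ^ 2 + √B) := by
  obtain ⟨C, hC, hcard⟩ := card_prime_quadruples_le
  obtain ⟨Z, hZ, hsum⟩ := exists_sum_one_div_mul_sqrt_le
  refine ⟨C * (2 + 192 * 8 * Z), by positivity, fun B D q i x S hB hp hD hXB hx hS => ?_⟩
  have hL : 0 < Real.log B := Real.log_pos (by linarith)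
  have hX : (0 : ℝ) < x i := by exact_mod_cast hp.pos
  have h1 := fun y hy => exists_scale (hS y hy).2.2.1 hp.pos hx fun j => ((hS y hy).2.1 j).2
  have h2 := fun y hy => (hS y hy).2.2.2
  choose! k hk hkabs hkle using h1
  choose! d hd hdD hdvd hdle using h2
  set K := Nat.log 2 (x i) + 1 with hK
  set W := √B / Real.log B ^ 3 with hW
  have hW0 : 0 ≤ W := by positivity
  have hmaps : ∀ y ∈ S, (d y, k y) ∈ Icc 1 D ×ˢ range K := fun y hy => by
    rw [mem_product, mem_Icc, mem_range]
    exact ⟨⟨hd y hy, hdD y hy⟩, hk y hy⟩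
  have hle : ∀ y ∈ S, 1 / detXY x y ≤ (d y : ℝ) / 4 ^ k y := fun y hy =>
    (hdle y hy).trans (div_le_div_of_nonneg_left (Nat.cast_nonneg _) (by positivity) (hkle y hy))
  have hfib : ∀ r ∈ Icc 1 D ×ˢ range K, ∑ y ∈ S with (d y, k y) = r, (d y : ℝ) / 4 ^ k y ≤
      C * W * ((1 + (2 * 4 ^ (r.2 + 1) / ((x i : ℝ) * r.1)) ^ 2 *
        √(2 * 4 ^ (r.2 + 1) / ((x i : ℝ) * r.1))) * ((r.1 : ℝ) / 4 ^ r.2)) := by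
    rintro ⟨δ, κ⟩ hr
    rw [mem_product, mem_Icc, mem_range] at hr
    have hc := hcard B (4 ^ (κ + 1)) δ q i x {y ∈ S | (d y, k y) = (δ, κ)} hB hr.1.1
      (by positivity) hp.pos
      (hp.coprime_iff_not_dvd.2 fun h => (hr.1.2.trans_lt hD).not_ge
        (Nat.le_of_dvd hr.1.1 h)).symm ?_ ?_ ?_ ?_
    · calc ∑ y ∈ S with (d y, k y) = (δ, κ), (d y : ℝ) / 4 ^ k y
          = ∑ y ∈ S with (d y, k y) = (δ, κ), (δ : ℝ) / 4 ^ κ := sum_congr rfl fun y hy => by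
            have := (mem_filter.1 hy).2
            rw [Prod.mk.injEq] at this
            rw [this.1, this.2]
        _ = ({y ∈ S | (d y, k y) = (δ, κ)}.card : ℝ) * ((δ : ℝ) / 4 ^ κ) := by
            rw [sum_const, nsmul_eq_mul]
        _ ≤ _ := mul_le_mul_of_nonneg_right hc (by positivity)
        _ = _ := by ring
    · exact fun y hy => (hS y (mem_filter.1 hy).1).1
    · exact fun y hy j => ⟨((hS y (mem_filter.1 hy).1).2.1 j).1,
        le_trans (by exact_mod_cast ((hS y (mem_filter.1 hy).1).2.1 j).2) hXB⟩
    · intro y hy j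
      have h3 := (mem_filter.1 hy).2
      rw [Prod.mk.injEq] at h3
      rw [← h3.1]
      exact hdvd y (mem_filter.1 hy).1 i j
    · intro y hy j
      have h3 := (mem_filter.1 hy).2
      rw [Prod.mk.injEq] at h3
      rw [← h3.2]
      exact hkabs y (mem_filter.1 hy).1 j
  have hKX : (2 : ℝ) ^ K ≤ 2 * x i := by
    have := Nat.pow_log_le_self 2 hp.ne_zero
    rw [hK, pow_succ, mul_comm]
    have h3 : (2 : ℝ) ^ Nat.log 2 (x i) ≤ x i := by exact_mod_cast this
    linarith
  calc ∑ y ∈ S, 1 / detXY x y ≤ ∑ y ∈ S, (d y : ℝ) / 4 ^ k y := sum_le_sum hle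
    _ = ∑ r ∈ Icc 1 D ×ˢ range K, ∑ y ∈ S with (d y, k y) = r, (d y : ℝ) / 4 ^ k y :=
        (sum_fiberwise_of_maps_to hmaps _).symm
    _ ≤ _ := sum_le_sum hfib
    _ = C * W * ∑ δ ∈ Icc 1 D, ∑ κ ∈ range K,
        ((1 + (2 * 4 ^ (κ + 1) / ((x i : ℝ) * δ)) ^ 2 *
        √(2 * 4 ^ (κ + 1) / ((x i : ℝ) * δ))) * ((δ : ℝ) / 4 ^ κ)) := by
        rw [← mul_sum, sum_product]
    _ ≤ C * W * ∑ δ ∈ Icc 1 D, (2 * (D : ℝ) + 192 * 8 * √(x i : ℝ) * (1 / ((δ : ℝ) * √δ))) := by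
        refine mul_le_mul_of_nonneg_left (sum_le_sum fun δ hδ => ?_) (by positivity)
        have h3 := (mem_Icc.1 hδ)
        have h4 : (0 : ℝ) < δ := by exact_mod_cast h3.1
        have h5 : (δ : ℝ) ≤ D := by exact_mod_cast h3.2
        refine (sum_geometric_weights_le hX h4 K hKX).trans ?_
        gcongr
    _ = C * W * (2 * (D : ℝ) ^ 2 + 192 * 8 * √(x i : ℝ) * ∑ δ ∈ Icc 1 D, 1 / ((δ : ℝ) * √δ)) := by
        rw [sum_add_distrib, sum_const, Nat.card_Icc, ← mul_sum, nsmul_eq_mul,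
          Nat.add_sub_cancel]
        ring
    _ ≤ C * W * (2 * (D : ℝ) ^ 2 + 192 * 8 * √B * Z) := by
        gcongr
        exact hsum D
    _ ≤ C * W * ((2 + 192 * 8 * Z) * (D ^ 2 + √B)) := by
        refine mul_le_mul_of_nonneg_left ?_ (by positivity)
        have h3 : 0 ≤ Z * (D : ℝ) ^ 2 := by positivity
        have h4 := Real.sqrt_nonneg B
        linarith
    _ = _ := by ring

theorem mem_primesLE_floor {B : ℝ} {n : ℕ} (hB : 0 ≤ B) :
    n ∈ Nat.primesLE ⌊B⌋₊ ↔ n.Prime ∧ (n : ℝ) ≤ B := by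
  rw [Nat.mem_primesLE, Nat.le_floor_iff hB, and_comm]

theorem sum_small_index_pivot_le : ∃ C > (0 : ℝ), ∀ (B : ℝ) (D : ℕ) (i : Fin 4)
    (S : Finset ((Fin 4 → ℕ) × (Fin 4 → ℕ))), 3 ≤ B →
    (∀ p ∈ S, (∀ j, (p.1 j).Prime ∧ (p.1 j : ℝ) ≤ B) ∧ (∀ j, (p.2 j).Prime ∧ (p.2 j : ℝ) ≤ B) ∧
      (∀ j, p.1 j ≤ p.1 i ∧ p.2 j ≤ p.1 i) ∧ D < p.1 i ∧ SmallIndex D p.1 p.2) →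
    ∑ p ∈ S, 1 / detXY p.1 p.2 ≤ C * (B ^ 5 * √B / Real.log B ^ 8) * (D ^ 2 + √B) := by
  obtain ⟨C, hC, hfiber⟩ := sum_small_index_fiber_le
  obtain ⟨C', hC', hpi⟩ := primeCounting_le_mul_div_log
  refine ⟨C' ^ 5 * C, by positivity, fun B D i S hB hS => ?_⟩
  have hB0 : 0 ≤ B := by linarith
  have hL : 0 < Real.log B := Real.log_pos (by linarith)
  set P := Nat.primesLE ⌊B⌋₊ with hP
  have hPcard : (P.card : ℝ) ≤ C' * B / Real.log B := by
    rw [hP, Nat.primesLE_card_eq_primeCounting]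
    exact hpi B (by linarith)
  set W := C * (√B / Real.log B ^ 3) * (D ^ 2 + √B) with hW
  have hmaps : ∀ p ∈ S, (p.1, p.2 i) ∈ (Fintype.piFinset fun _ : Fin 4 => P) ×ˢ P := by
    intro p hp
    obtain ⟨h1, h2, -⟩ := hS p hp
    rw [mem_product, Fintype.mem_piFinset]
    exact ⟨fun j => (mem_primesLE_floor hB0).2 (h1 j), (mem_primesLE_floor hB0).2 (h2 i)⟩
  have hfib : ∀ r ∈ (Fintype.piFinset fun _ : Fin 4 => P) ×ˢ P,
      ∑ p ∈ S with (p.1, p.2 i) = r, 1 / detXY p.1 p.2 ≤ W := by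
    rintro ⟨x, q⟩ -
    rcases eq_empty_or_nonempty {p ∈ S | (p.1, p.2 i) = (x, q)} with h0 | ⟨p₀, hp₀⟩
    · rw [h0, sum_empty]
      positivity
    · set T := {p ∈ S | (p.1, p.2 i) = (x, q)} with hT
      have hmem : ∀ p ∈ T, p ∈ S ∧ p.1 = x ∧ p.2 i = q := fun p hp => by
        rw [hT, mem_filter, Prod.mk.injEq] at hp
        exact hp
      obtain ⟨hp₀S, rfl, hq⟩ := hmem p₀ hp₀
      obtain ⟨h1, h2, h3, h4, h5⟩ := hS p₀ hp₀S
      have hinj : Set.InjOn Prod.snd (T : Set ((Fin 4 → ℕ) × (Fin 4 → ℕ))) :=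
        fun p hp p' hp' h => Prod.ext ((hmem p hp).2.1.trans (hmem p' hp').2.1.symm) h
      calc ∑ p ∈ T, 1 / detXY p.1 p.2 = ∑ p ∈ T, 1 / detXY p₀.1 p.2 :=
            sum_congr rfl fun p hp => by rw [(hmem p hp).2.1]
        _ = ∑ y ∈ T.image Prod.snd, 1 / detXY p₀.1 y := by rw [sum_image hinj]
        _ ≤ W := by
          refine hfiber B D q i p₀.1 _ hB (h1 i).1 h4 (h1 i).2 (fun j => (h3 j).1) fun y hy => ?_
          obtain ⟨p, hp, rfl⟩ := mem_image.1 hy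
          obtain ⟨hpS, hpx, hpq⟩ := hmem p hp
          obtain ⟨k1, k2, k3, k4, k5⟩ := hS p hpS
          rw [← hpx]
          exact ⟨hpq, fun j => ⟨(k2 j).1, (k3 j).2⟩, k5⟩
  calc ∑ p ∈ S, 1 / detXY p.1 p.2
      = ∑ r ∈ (Fintype.piFinset fun _ : Fin 4 => P) ×ˢ P,
          ∑ p ∈ S with (p.1, p.2 i) = r, 1 / detXY p.1 p.2 :=
        (sum_fiberwise_of_maps_to hmaps _).symm
    _ ≤ (P.card : ℝ) ^ 5 * W := by
        refine (sum_le_sum hfib).trans_eq ?_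
        rw [sum_const, card_product, Fintype.card_piFinset, prod_const, card_univ,
          Fintype.card_fin, nsmul_eq_mul]
        push_cast
        ring
    _ ≤ (C' * B / Real.log B) ^ 5 * W := by gcongr
    _ = C' ^ 5 * C * (B ^ 5 * √B / Real.log B ^ 8) * (D ^ 2 + √B) := by
        rw [hW]
        field_simp

theorem pluckerSq_comm (u v : Fin 4 → ℤ) : pluckerSq u v = pluckerSq v u := by
  rw [pluckerSq_eq, pluckerSq_eq, mul_comm (∑ i, u i ^ 2)]
  simp only [mul_comm (u _)]

theorem SmallIndex.symm {D : ℕ} {x y : Fin 4 → ℕ} (h : SmallIndex D x y) : SmallIndex D y x := by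
  obtain ⟨h1, d, h2, h3, h4, h5⟩ := h
  rw [SmallIndex, pluckerSq_comm, detXY_comm]
  refine ⟨h1, d, h2, h3, fun i j => ?_, h5⟩
  have := h4 j i
  rwa [mul_comm, mul_comm (x i : ℤ)] at this

theorem sum_small_index_le : ∃ C > (0 : ℝ), ∀ (B : ℝ) (D : ℕ)
    (S : Finset ((Fin 4 → ℕ) × (Fin 4 → ℕ))), 3 ≤ B →
    (∀ p ∈ S, (∀ j, (p.1 j).Prime ∧ (p.1 j : ℝ) ≤ B) ∧ (∀ j, (p.2 j).Prime ∧ (p.2 j : ℝ) ≤ B) ∧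
      SmallIndex D p.1 p.2) →
    ∑ p ∈ S, 1 / detXY p.1 p.2 ≤
      C * (B ^ 5 * √B / Real.log B ^ 8) * (D ^ 2 + √B) + (D + 1) ^ 8 := by
  obtain ⟨C, hC, h⟩ := sum_small_index_pivot_le
  refine ⟨8 * C, by positivity, fun B D S hB hS => ?_⟩
  set W := C * (B ^ 5 * √B / Real.log B ^ 8) * (D ^ 2 + √B) with hW
  set f : (Fin 4 → ℕ) × (Fin 4 → ℕ) → ℝ := fun p => 1 / detXY p.1 p.2 with hf
  have hf0 : ∀ p, 0 ≤ f p := fun p => one_div_detXY_nonneg p.1 p.2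
  set T₁ : Fin 4 → Finset ((Fin 4 → ℕ) × (Fin 4 → ℕ)) := fun i =>
    {p ∈ S | (∀ j, p.1 j ≤ p.1 i ∧ p.2 j ≤ p.1 i) ∧ D < p.1 i} with hT₁
  set T₂ : Fin 4 → Finset ((Fin 4 → ℕ) × (Fin 4 → ℕ)) := fun i =>
    {p ∈ S | (∀ j, p.2 j ≤ p.2 i ∧ p.1 j ≤ p.2 i) ∧ D < p.2 i} with hT₂
  set T₃ : Finset ((Fin 4 → ℕ) × (Fin 4 → ℕ)) :=
    (Fintype.piFinset fun _ => range (D + 1)) ×ˢ (Fintype.piFinset fun _ => range (D + 1)) with hT₃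
  have hsub : S ⊆ (univ.biUnion fun i => T₁ i ∪ T₂ i) ∪ T₃ := by
    intro p hp
    obtain ⟨i, -, hi⟩ := exists_max_image univ p.1 univ_nonempty
    obtain ⟨j, -, hj⟩ := exists_max_image univ p.2 univ_nonempty
    simp only [mem_union, mem_biUnion, mem_univ, true_and]
    by_cases hD : p.1 i ≤ D ∧ p.2 j ≤ D
    · right
      rw [hT₃, mem_product, Fintype.mem_piFinset, Fintype.mem_piFinset]
      exact ⟨fun k => mem_range.2 (Nat.lt_succ_of_le ((hi k (mem_univ k)).trans hD.1)),
        fun k => mem_range.2 (Nat.lt_succ_of_le ((hj k (mem_univ k)).trans hD.2))⟩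
    · left
      rcases le_total (p.2 j) (p.1 i) with hij | hij
      · refine ⟨i, Or.inl (mem_filter.2 ⟨hp, fun k => ⟨hi k (mem_univ k),
          (hj k (mem_univ k)).trans hij⟩, ?_⟩)⟩
        omega
      · refine ⟨j, Or.inr (mem_filter.2 ⟨hp, fun k => ⟨hj k (mem_univ k),
          (hi k (mem_univ k)).trans hij⟩, ?_⟩)⟩
        omega
  have h₁ : ∀ i, ∑ p ∈ T₁ i, f p ≤ W := fun i => by
    refine h B D i _ hB fun p hp => ?_
    rw [hT₁, mem_filter] at hp
    obtain ⟨h1, h2, h3⟩ := hS p hp.1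
    exact ⟨h1, h2, hp.2.1, hp.2.2, h3⟩
  have h₂ : ∀ i, ∑ p ∈ T₂ i, f p ≤ W := fun i => by
    have hswap : ∑ p ∈ T₂ i, f p = ∑ p ∈ (T₂ i).image Prod.swap, f p := by
      rw [sum_image Prod.swap_injective.injOn]
      exact sum_congr rfl fun p _ => by rw [hf]; exact congrArg _ (detXY_comm p.1 p.2)
    rw [hswap]
    refine h B D i _ hB fun p hp => ?_
    obtain ⟨p, hp', rfl⟩ := mem_image.1 hp
    clear hp
    rw [hT₂, mem_filter] at hp'
    obtain ⟨h1, h2, h3⟩ := hS p hp'.1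
    exact ⟨h2, h1, hp'.2.1, hp'.2.2, h3.symm⟩
  have h₃ : ∑ p ∈ T₃, f p ≤ (D + 1) ^ 8 := by
    calc ∑ p ∈ T₃, f p ≤ ∑ p ∈ T₃, 1 := sum_le_sum fun p _ => one_div_detXY_le_one p.1 p.2
      _ = (D + 1) ^ 8 := by
        rw [sum_const, hT₃, card_product, Fintype.card_piFinset, prod_const, card_univ,
          Fintype.card_fin, card_range, nsmul_eq_mul]
        push_cast
        ring
  have hunion : ∀ s t : Finset ((Fin 4 → ℕ) × (Fin 4 → ℕ)),
      ∑ p ∈ s ∪ t, f p ≤ ∑ p ∈ s, f p + ∑ p ∈ t, f p := fun s t => by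
    rw [← sum_union_inter]
    linarith [sum_nonneg fun p (_ : p ∈ s ∩ t) => hf0 p]
  have hbi : ∀ I : Finset (Fin 4),
      ∑ p ∈ I.biUnion (fun i => T₁ i ∪ T₂ i), f p ≤ ∑ _i ∈ I, (W + W) := fun I => by
    induction I using Finset.induction_on with
    | empty => simp
    | insert i I hi ih =>
      rw [biUnion_insert, sum_insert hi]
      exact (hunion _ _).trans (add_le_add ((hunion _ _).trans (add_le_add (h₁ i) (h₂ i))) ih)
  calc ∑ p ∈ S, f p ≤ ∑ p ∈ (univ.biUnion fun i => T₁ i ∪ T₂ i) ∪ T₃, f p :=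
        sum_le_sum_of_subset_of_nonneg hsub fun p _ _ => hf0 p
    _ ≤ ∑ _i : Fin 4, (W + W) + (D + 1) ^ 8 := (hunion _ _).trans (add_le_add (hbi univ) h₃)
    _ = 8 * C * (B ^ 5 * √B / Real.log B ^ 8) * (D ^ 2 + √B) + (D + 1) ^ 8 := by
        rw [sum_const, card_univ, Fintype.card_fin, nsmul_eq_mul, hW]
        push_cast
        ring

theorem log_pow_le_mul_sqrt (n : ℕ) :
    ∃ C > (0 : ℝ), ∀ B : ℝ, 3 ≤ B → Real.log B ^ n ≤ C * √B := by
  refine ⟨2 ^ n * n.factorial, by positivity, fun B hB => ?_⟩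
  have hL : 0 < Real.log B := Real.log_pos (by linarith)
  have h := Real.pow_div_factorial_le_exp (1 / 2 * Real.log B) (by positivity) n
  rw [mul_comm (1 / 2 : ℝ), ← Real.rpow_def_of_pos (by linarith), ← Real.sqrt_eq_rpow, mul_pow,
    div_le_iff₀ (by positivity), div_pow, one_pow, mul_one_div, div_le_iff₀ (by positivity)] at h
  linarith

theorem pluckerSq_pos_trichotomy {x y : Fin 4 → ℕ} (D : ℕ)
    (h : 0 < pluckerSq (fun i => (x i : ℤ)) (fun i => (y i : ℤ))) :
    SmallIndex D x y ∨ ∃ u v : Fin 4 → ℤ, ∃ a b c e : ℤ, (fun i => (x i : ℤ)) = a • u + b • v ∧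
        (fun i => (y i : ℤ)) = c • u + e • v ∧ PrimPair u v ∧
        u ∈ satSpan (fun i => (x i : ℤ)) (fun i => (y i : ℤ)) ∧
        v ∈ satSpan (fun i => (x i : ℤ)) (fun i => (y i : ℤ)) ∧
        3 * ((∑ i, u i ^ 2) * ∑ i, v i ^ 2) ≤ 4 * pluckerSq u v ∧
        (D : ℝ) ≤ |(a * e - b * c : ℤ)| := by
  obtain ⟨u, v, a, b, c, e, hx, hy, huv, hu, hv, hred⟩ := exists_reduced_decomposition _ _ h
  rcases le_total (a * e - b * c).natAbs D with hd | hd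
  · left
    have h1 := pluckerSq_combination (k := 1) (l := 1) (z := fun i => (x i : ℤ))
      (w := fun i => (y i : ℤ)) (u := u) (v := v) (a := a) (b := b) (c := c) (e := e)
      (by simpa using hx) (by simpa using hy)
    simp only [one_pow, mul_one, one_mul] at h1
    have h0 : a * e - b * c ≠ 0 := by
      intro h2
      rw [h2] at h1
      simp [h1] at h
    refine ⟨h, (a * e - b * c).natAbs, Int.natAbs_pos.2 h0, hd, fun i j => ?_, ?_⟩
    · have hx' : ∀ i, (x i : ℤ) = a * u i + b * v i := fun i => by simpa using congrFun hx i
      have hy' : ∀ i, (y i : ℤ) = c * u i + e * v i := fun i => by simpa using congrFun hy i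
      rw [Int.natAbs_dvd]
      refine ⟨u i * v j - u j * v i, ?_⟩
      rw [hx', hx', hy', hy']
      ring
    · refine (one_div_detXY_le huv hu hv).trans_eq ?_
      have hP : (0 : ℝ) < pluckerSq u v := by exact_mod_cast huv.pos
      have h2 : (0 : ℝ) < |((a * e - b * c : ℤ) : ℝ)| := abs_pos.2 (by exact_mod_cast h0)
      have h3 := Real.sqrt_pos.2 hP
      rw [h1, Int.cast_mul, Int.cast_pow, Real.sqrt_mul (sq_nonneg _), Real.sqrt_sq_eq_abs,
        Nat.cast_natAbs, Int.cast_abs]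
      field_simp
  · right
    refine ⟨u, v, a, b, c, e, hx, hy, huv, hu, hv, hred, ?_⟩
    rw [Int.abs_eq_natAbs]
    exact_mod_cast hd

/-- The set `Ω(B)` as a finset. -/
noncomputable def omegaFinset (B : ℝ) : Finset ((Fin 4 → ℕ) × (Fin 4 → ℕ)) :=
  (Fintype.piFinset fun _ : Fin 4 => Nat.primesLE ⌊B⌋₊).offDiag

theorem mem_omegaFinset {B : ℝ} (hB : 0 ≤ B) {p : (Fin 4 → ℕ) × (Fin 4 → ℕ)} :
    p ∈ omegaFinset B ↔ (∀ i, (p.1 i).Prime ∧ (p.1 i : ℝ) ≤ B) ∧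
      (∀ i, (p.2 i).Prime ∧ (p.2 i : ℝ) ≤ B) ∧ p.1 ≠ p.2 := by
  simp only [omegaFinset, mem_offDiag, Fintype.mem_piFinset, mem_primesLE_floor hB]

theorem EB_eq_sum {B : ℝ} (hB : 0 ≤ B) :
    EB B = Real.log B ^ 8 * ∑ p ∈ omegaFinset B, 1 / detXY p.1 p.2 := by
  have : OmegaB B = omegaFinset B := by
    ext p
    rw [mem_coe, mem_omegaFinset hB]
    rfl
  rw [EB, this, finsum_mem_coe_finset]

theorem one_le_log {B : ℝ} (hB : 3 ≤ B) : 1 ≤ Real.log B := by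
  rw [Real.le_log_iff_exp_le (by linarith)]
  linarith [Real.exp_one_lt_three]

theorem EB_lower_bound : ∃ K > (0 : ℝ), ∀ B : ℝ, 3 ≤ B → K * B ^ 6 ≤ EB B := by
  obtain ⟨c, hc, hpi⟩ := mul_div_log_le_primeCounting
  refine ⟨c ^ 8 / 8, by positivity, fun B hB => ?_⟩
  have hB0 : 0 < B := by linarith
  have hL := one_le_log hB
  set n := Nat.primeCounting ⌊B⌋₊ with hn
  have hn2 : 2 ≤ n := by
    have h3 : Nat.primeCounting 3 = 2 := by decide
    rw [← h3]
    exact Nat.monotone_primeCounting (Nat.le_floor (by exact_mod_cast hB))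
  have hcard : ((omegaFinset B).card : ℝ) = (n : ℝ) ^ 8 - (n : ℝ) ^ 4 := by
    rw [omegaFinset, offDiag_card, Fintype.card_piFinset, prod_const, card_univ, Fintype.card_fin,
      Nat.primesLE_card_eq_primeCounting, ← hn, Nat.cast_sub (Nat.le_mul_self _)]
    push_cast
    ring
  have hcard' : (n : ℝ) ^ 8 / 2 ≤ (omegaFinset B).card := by
    have h1 : (2 : ℝ) ≤ n := by exact_mod_cast hn2
    have h2 : (2 : ℝ) ^ 4 ≤ (n : ℝ) ^ 4 := by gcongr
    rw [hcard]
    nlinarith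
  rw [EB_eq_sum hB0.le]
  calc c ^ 8 / 8 * B ^ 6
      = Real.log B ^ 8 * ((c * B / Real.log B) ^ 8 / 2 * (1 / (4 * B ^ 2))) := by
        field_simp
        norm_num
    _ ≤ Real.log B ^ 8 * ((n : ℝ) ^ 8 / 2 * (1 / (4 * B ^ 2))) := by
        gcongr
        exact hpi B hB
    _ ≤ Real.log B ^ 8 * ((omegaFinset B).card * (1 / (4 * B ^ 2))) := by gcongr
    _ = Real.log B ^ 8 * ∑ p ∈ omegaFinset B, 1 / (4 * B ^ 2) := by rw [sum_const, nsmul_eq_mul]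
    _ ≤ _ := by
        refine mul_le_mul_of_nonneg_left (sum_le_sum fun p hp => ?_) (by positivity)
        obtain ⟨h1, h2, h3⟩ := (mem_omegaFinset hB0.le).1 hp
        obtain ⟨h4, h5⟩ := detXY_pos_and_le (fun i => (h1 i).1) (fun i => (h2 i).1) h3
          (fun i => (h1 i).2) fun i => (h2 i).2
        exact one_div_le_one_div_of_le h4 h5

/-- The contribution of the linearly dependent pairs. -/
theorem sum_dependent_le : ∃ C > (0 : ℝ), ∀ (B : ℝ) (S : Finset ((Fin 4 → ℕ) × (Fin 4 → ℕ))),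
    3 ≤ B → (∀ p ∈ S, p ∈ omegaFinset B ∧
      ¬ 0 < pluckerSq (fun i => (p.1 i : ℤ)) (fun i => (p.2 i : ℤ))) →
    ∑ p ∈ S, 1 / detXY p.1 p.2 ≤ C * B ^ 2 := by
  obtain ⟨C, hC, hpi⟩ := primeCounting_le_mul_div_log
  refine ⟨C ^ 2, by positivity, fun B S hB hS => ?_⟩
  have hB0 : 0 ≤ B := by linarith
  have hL := one_le_log hB
  set P := Nat.primesLE ⌊B⌋₊ with hP
  have hPcard : (P.card : ℝ) ≤ C * B := by
    rw [hP, Nat.primesLE_card_eq_primeCounting]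
    exact (hpi B (by linarith)).trans (div_le_self (by positivity) hL)
  have hsub : S ⊆ (P ×ˢ P).image fun r => ((fun _ => r.1), fun _ => r.2) := by
    intro p hp
    obtain ⟨h1, h2, h3⟩ := (mem_omegaFinset hB0).1 (hS p hp).1
    obtain ⟨q, r, hq, hr⟩ := eq_const_of_pluckerSq_eq_zero (fun i => (h1 i).1)
      (fun i => (h2 i).1) h3 (hS p hp).2
    refine mem_image.2 ⟨(p.1 0, p.2 0), mem_product.2
      ⟨(mem_primesLE_floor hB0).2 (h1 0), (mem_primesLE_floor hB0).2 (h2 0)⟩, ?_⟩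
    refine Prod.ext ?_ ?_
    · rw [hq]
    · rw [hr]
  have hcard := (card_le_card hsub).trans card_image_le
  rw [card_product] at hcard
  calc ∑ p ∈ S, 1 / detXY p.1 p.2 ≤ ∑ p ∈ S, 1 :=
        sum_le_sum fun p _ => one_div_detXY_le_one p.1 p.2
    _ = (S.card : ℝ) := by rw [sum_const, nsmul_eq_mul, mul_one]
    _ ≤ (P.card : ℝ) * P.card := by exact_mod_cast hcard
    _ ≤ (C * B) * (C * B) := by gcongr
    _ = C ^ 2 * B ^ 2 := by ring

theorem EB_upper_bound : ∃ K > (0 : ℝ), ∀ B : ℝ, 3 ≤ B → EB B ≤ K * B ^ 6 := by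
  obtain ⟨C₁, hC₁, hdep⟩ := sum_dependent_le
  obtain ⟨C₂, hC₂, hlarge⟩ := sum_large_index_le
  obtain ⟨C₃, hC₃, hsmall⟩ := sum_small_index_le
  obtain ⟨c₁, hc₁, hlog8⟩ := log_pow_le_mul_sqrt 8
  obtain ⟨c₂, hc₂, hlog32⟩ := log_pow_le_mul_sqrt 32
  obtain ⟨c₃, hc₃, hlog136⟩ := log_pow_le_mul_sqrt 136
  refine ⟨C₁ * c₁ + C₂ + C₃ * (4 * c₂ + 1) + 3 ^ 8 * c₃, by positivity, fun B hB => ?_⟩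
  have hB0 : 0 < B := by linarith
  set L := Real.log B with hL
  have hL1 : 1 ≤ L := one_le_log hB
  have hL16 : 1 ≤ L ^ 16 := one_le_pow₀ hL1
  set D := ⌈L ^ 16⌉₊ with hD
  have hD1 : L ^ 16 ≤ D := Nat.le_ceil _
  have hD2 : (D : ℝ) ≤ 2 * L ^ 16 := by linarith [Nat.ceil_lt_add_one (zero_le_one.trans hL16)]
  have hD0 : (0 : ℝ) < D := by linarith
  have hsqrt : √B * √B = B := Real.mul_self_sqrt hB0.le
  have hsqrt1 : 1 ≤ √B := Real.one_le_sqrt.2 (by linarith)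
  have hsqrtB : √B ≤ B := by nlinarith
  classical
  set f : (Fin 4 → ℕ) × (Fin 4 → ℕ) → ℝ := fun p => 1 / detXY p.1 p.2 with hf
  have hf0 : ∀ p, 0 ≤ f p := fun p => one_div_detXY_nonneg p.1 p.2
  set Ω := omegaFinset B with hΩ
  set dep : (Fin 4 → ℕ) × (Fin 4 → ℕ) → Prop := fun p =>
    ¬ 0 < pluckerSq (fun i => (p.1 i : ℤ)) (fun i => (p.2 i : ℤ)) with hdef
  have h1 : ∑ p ∈ Ω with dep p, f p ≤ C₁ * B ^ 2 :=
    hdep B _ hB fun p hp => mem_filter.1 hp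
  have h2 : ∑ p ∈ Ω with ¬ dep p ∧ SmallIndex D p.1 p.2, f p ≤
      C₃ * (B ^ 5 * √B / L ^ 8) * (D ^ 2 + √B) + (D + 1) ^ 8 :=
    hsmall B D _ hB fun p hp => by
      obtain ⟨h3, h4⟩ := mem_filter.1 hp
      obtain ⟨h5, h6, -⟩ := (mem_omegaFinset hB0.le).1 h3
      exact ⟨h5, h6, h4.2⟩
  have h3 : ∑ p ∈ Ω with ¬ dep p ∧ ¬ SmallIndex D p.1 p.2, f p ≤ C₂ * B ^ 6 * L ^ 8 / D :=
    hlarge B D _ hB hD0 fun p hp => by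
      obtain ⟨h3, h4, h4'⟩ := mem_filter.1 hp
      obtain ⟨h5, h6, -⟩ := (mem_omegaFinset hB0.le).1 h3
      exact ⟨fun i => (h5 i).2, fun i => (h6 i).2,
        (pluckerSq_pos_trichotomy D (not_not.1 h4)).resolve_left h4'⟩
  have hsum : ∑ p ∈ Ω, f p ≤ C₁ * B ^ 2 +
      (C₃ * (B ^ 5 * √B / L ^ 8) * (D ^ 2 + √B) + (D + 1) ^ 8 + C₂ * B ^ 6 * L ^ 8 / D) := by
    rw [← sum_filter_add_sum_filter_not Ω dep,
      ← sum_filter_add_sum_filter_not ({p ∈ Ω | ¬ dep p}) fun p => SmallIndex D p.1 p.2,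
      filter_filter, filter_filter]
    exact add_le_add h1 (add_le_add h2 h3)
  rw [EB_eq_sum hB0.le]
  have hB2 : √B * B ^ 2 ≤ B ^ 6 := by
    calc √B * B ^ 2 ≤ B * B ^ 2 := by gcongr
      _ = B ^ 3 := by ring
      _ ≤ B ^ 6 := pow_le_pow_right₀ (by linarith) (by norm_num)
  have e1 : L ^ 8 * (C₁ * B ^ 2) ≤ C₁ * c₁ * B ^ 6 := by
    calc L ^ 8 * (C₁ * B ^ 2) ≤ (c₁ * √B) * (C₁ * B ^ 2) := by
          gcongr
          exact hlog8 B hB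
      _ = C₁ * c₁ * (√B * B ^ 2) := by ring
      _ ≤ _ := by gcongr
  have e2 : L ^ 8 * (C₃ * (B ^ 5 * √B / L ^ 8) * (D ^ 2 + √B)) ≤ C₃ * (4 * c₂ + 1) * B ^ 6 := by
    have h4 : (D : ℝ) ^ 2 ≤ 4 * (c₂ * √B) := by
      calc (D : ℝ) ^ 2 ≤ (2 * L ^ 16) ^ 2 := by gcongr
        _ = 4 * L ^ 32 := by ring
        _ ≤ _ := by
          gcongr
          exact hlog32 B hB
    calc L ^ 8 * (C₃ * (B ^ 5 * √B / L ^ 8) * (D ^ 2 + √B))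
        = C₃ * (B ^ 5 * √B) * (D ^ 2 + √B) := by field_simp
      _ ≤ C₃ * (B ^ 5 * √B) * (4 * (c₂ * √B) + √B) := by gcongr
      _ = C₃ * (4 * c₂ + 1) * (B ^ 5 * (√B * √B)) := by ring
      _ = _ := by
        rw [hsqrt]
        ring
  have e3 : L ^ 8 * ((D : ℝ) + 1) ^ 8 ≤ 3 ^ 8 * c₃ * B ^ 6 := by
    calc L ^ 8 * ((D : ℝ) + 1) ^ 8 ≤ L ^ 8 * (3 * L ^ 16) ^ 8 := by
          gcongr
          linarith
      _ = 3 ^ 8 * L ^ 136 := by ring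
      _ ≤ 3 ^ 8 * (c₃ * √B) := by
          gcongr
          exact hlog136 B hB
      _ ≤ 3 ^ 8 * (c₃ * B ^ 6) := by
          gcongr
          exact hsqrtB.trans (le_self_pow₀ (by linarith) (by norm_num))
      _ = _ := by ring
  have e4 : L ^ 8 * (C₂ * B ^ 6 * L ^ 8 / D) ≤ C₂ * B ^ 6 := by
    rw [mul_div_assoc', div_le_iff₀ hD0]
    calc L ^ 8 * (C₂ * B ^ 6 * L ^ 8) = C₂ * B ^ 6 * L ^ 16 := by ring
      _ ≤ _ := by gcongr
  calc L ^ 8 * ∑ p ∈ Ω, f p ≤ _ := mul_le_mul_of_nonneg_left hsum (by positivity)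
    _ ≤ _ := by linarith

/-- Lemma 4.5: `B⁶ ≪ E(B) ≪ B⁶·(max{1, log log log B})⁸` for `B ≥ 3`. -/
theorem EB_upper_and_lower_bounds :
    ∃ K₁ > (0 : ℝ), ∃ K₂ > (0 : ℝ), ∀ B : ℝ, 3 ≤ B →
      K₁ * B ^ 6 ≤ EB B ∧
      EB B ≤ K₂ * B ^ 6 * (max 1 (Real.log (Real.log (Real.log B)))) ^ 8 := by
  obtain ⟨K₁, hK₁, h₁⟩ := EB_lower_bound
  obtain ⟨K₂, hK₂, h₂⟩ := EB_upper_bound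
  refine ⟨K₁, hK₁, K₂, hK₂, fun B hB => ⟨h₁ B hB, (h₂ B hB).trans ?_⟩⟩
  have hB0 : 0 ≤ B := by linarith
  exact le_mul_of_one_le_right (by positivity) (one_le_pow₀ (le_max_left _ _))
end

section
/- Let A and B be sufficiently large real numbers with A ≤ B³, and let C > 0 and κ > 0. Then #{a ∈ 𝕃^loc(A) : 𝔍_a(B) ≤ C/(log log B)^κ} ≪ A⁴/(log log A)^{κ/3}, where the implied constant depends at most on C and κ. -/
open Filter MeasureTheory Finset Topology
open scoped ENNReal

/-- Two distinct indices in `Fin 4` can be completed to an enumeration of `Fin 4`. -/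
lemma Fin.exists_univ_four_eq (k j : Fin 4) (hkj : k ≠ j) :
    ∃ p q : Fin 4, k ≠ p ∧ k ≠ q ∧ j ≠ p ∧ j ≠ q ∧ p ≠ q ∧
      (Finset.univ : Finset (Fin 4)) = {k, j, p, q} := by
  revert k j
  decide

/-- Volume bound for the part of the slab `|⟨u,b⟩| ≤ ‖u‖N/(2γ)` inside the positive orthant of the
unit ball, when `b k` is the dominant coordinate and `b j` has the opposite sign. -/
lemma slab_volume_ge (b : Fin 4 → ℝ) (k j : Fin 4) (hk : 0 < b k) (hj : b j < 0)
    (hmax : ∀ l, |b l| ≤ b k) (N γ : ℝ) (hN : b k ≤ N) (hγ : 1 ≤ γ) :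
    (|b j| / b k) ^ 2 / 8192 ≤
      γ * (volume {u : Fin 4 → ℝ | Real.sqrt (∑ i, u i ^ 2) < 1 ∧ (∀ i, 0 < u i) ∧
        |∑ i, u i * b i| ≤ Real.sqrt (∑ i, u i ^ 2) * N / (2 * γ)}).toReal := by
  have hkj : k ≠ j := by
    rintro rfl
    linarith
  obtain ⟨p, q, hkp, hkq, hjp, hjq, hpq, huniv⟩ := Fin.exists_univ_four_eq k j hkj
  have hsum : ∀ g : Fin 4 → ℝ, ∑ i, g i = g k + (g j + (g p + g q)) := by
    intro g
    rw [huniv, Finset.sum_insert (by simp [*]), Finset.sum_insert (by simp [*]),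
      Finset.sum_pair hpq]
  have hprod : ∀ g : Fin 4 → ℝ, ∏ i, g i = g k * (g j * (g p * g q)) := by
    intro g
    rw [huniv, Finset.prod_insert (by simp [*]), Finset.prod_insert (by simp [*]),
      Finset.prod_pair hpq]
  have hall : ∀ P : Fin 4 → Prop, P k → P j → P p → P q → ∀ i, P i := by
    intro P h1 h2 h3 h4 i
    have hi := Finset.mem_univ i
    rw [huniv] at hi
    simp only [Finset.mem_insert, Finset.mem_singleton] at hi
    rcases hi with rfl | rfl | rfl | rfl <;> assumption
  set S := {u : Fin 4 → ℝ | Real.sqrt (∑ i, u i ^ 2) < 1 ∧ (∀ i, 0 < u i) ∧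
        |∑ i, u i * b i| ≤ Real.sqrt (∑ i, u i ^ 2) * N / (2 * γ)} with hS
  set e : ℝ := |b j| / b k with he
  have hγ0 : 0 < γ := by linarith
  have he0 : 0 < e := div_pos (abs_pos.2 hj.ne) hk
  have he1 : e ≤ 1 := (div_le_one hk).2 (hmax j)
  set lo : Fin 4 → ℝ := fun l => if l = j then 1 / 4 else 0 with hlo
  set hi : Fin 4 → ℝ := fun l => if l = j then 1 / 2 else if l = k then 1 / (8 * γ) else e / 16
    with hhi
  set box : Set (Fin 4 → ℝ) := Set.pi Set.univ fun l => Set.Ioo (lo l) (hi l) with hbox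
  set f : Module.Dual ℝ (Fin 4 → ℝ) := (b j / b k) • LinearMap.proj j +
    (b p / b k) • LinearMap.proj p + (b q / b k) • LinearMap.proj q with hf
  set T := LinearMap.transvection f (-Pi.single k (1 : ℝ)) with hT
  have hdet : LinearMap.det T = 1 := by
    rw [hT, LinearMap.transvection.det]
    simp [hf, hkj.symm, hkp.symm, hkq.symm]
  have hsub : T '' box ⊆ S := by
    rintro _ ⟨v, hv, rfl⟩
    simp only [hbox, Set.mem_pi, Set.mem_univ, true_imp_iff, Set.mem_Ioo, hlo, hhi] at hv
    have hvk := hv k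
    have hvj := hv j
    have hvp := hv p
    have hvq := hv q
    simp only [hkj, hkp.symm, hkq.symm, hjp.symm, hjq.symm, if_false, if_true] at hvk hvj hvp hvq
    have hfv : f v = b j / b k * v j + b p / b k * v p + b q / b k * v q := by simp [hf]
    have hTk : T v k = v k - f v := by
      simp [hT, LinearMap.transvection.apply, sub_eq_add_neg]
    have hTne : ∀ l, k ≠ l → T v l = v l := by
      intro l hl
      simp [hT, LinearMap.transvection.apply, hl.symm]
    have hbj : b j / b k = -e := by rw [he, abs_of_neg hj]; ring
    have hpa := abs_le.1 (show |b p / b k| ≤ 1 by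
      rw [abs_div, abs_of_pos hk]; exact (div_le_one hk).2 (hmax p))
    have hqa := abs_le.1 (show |b q / b k| ≤ 1 by
      rw [abs_div, abs_of_pos hk]; exact (div_le_one hk).2 (hmax q))
    rw [hbj] at hfv
    have hγ8 : 1 / (8 * γ) ≤ 1 / 8 := by
      rw [div_le_div_iff₀ (by positivity) (by norm_num)]
      linarith
    have hf_neg : f v < 0 := by
      rw [hfv]
      nlinarith [mul_pos he0 (sub_pos.2 hvj.1), mul_nonneg (sub_nonneg.2 hpa.2) hvp.1.le,
        mul_nonneg (sub_nonneg.2 hqa.2) hvq.1.le]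
    have hf_ge : -(5 / 8) ≤ f v := by
      rw [hfv]
      nlinarith [mul_nonneg (sub_nonneg.2 he1) (by linarith [hvj.1] : (0 : ℝ) ≤ v j),
        mul_nonneg (by linarith [hpa.1] : (0 : ℝ) ≤ b p / b k + 1) hvp.1.le,
        mul_nonneg (by linarith [hqa.1] : (0 : ℝ) ≤ b q / b k + 1) hvq.1.le]
    have hnorm : 1 / 4 ≤ Real.sqrt (∑ i, T v i ^ 2) := by
      apply Real.le_sqrt_of_sq_le
      rw [hsum, hTk, hTne j hkj, hTne p hkp, hTne q hkq]
      nlinarith [sq_nonneg (v k - f v), sq_nonneg (v p), sq_nonneg (v q)]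
    refine ⟨?_, hall _ ?_ ?_ ?_ ?_, ?_⟩
    · rw [Real.sqrt_lt' one_pos, hsum, hTk, hTne j hkj, hTne p hkp, hTne q hkq]
      have h1 : (v k - f v) ^ 2 ≤ (3 / 4) ^ 2 :=
        pow_le_pow_left₀ (by linarith) (by linarith) 2
      have h2 : (v j) ^ 2 ≤ (1 / 2) ^ 2 := pow_le_pow_left₀ (by linarith) (by linarith) 2
      have h3 : (v p) ^ 2 ≤ (1 / 16) ^ 2 := pow_le_pow_left₀ (by linarith) (by linarith) 2
      have h4 : (v q) ^ 2 ≤ (1 / 16) ^ 2 := pow_le_pow_left₀ (by linarith) (by linarith) 2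
      linarith
    · rw [hTk]; linarith
    · rw [hTne j hkj]; linarith
    · rw [hTne p hkp]; linarith
    · rw [hTne q hkq]; linarith
    · have hinner : ∑ i, T v i * b i = b k * v k := by
        rw [hsum, hTk, hTne j hkj, hTne p hkp, hTne q hkq, hfv, ← hbj]
        field_simp
        ring
      rw [hinner, abs_of_pos (mul_pos hk hvk.1)]
      calc b k * v k ≤ N * (1 / (8 * γ)) := by
            apply mul_le_mul hN hvk.2.le hvk.1.le (by linarith)
        _ = 1 / 4 * N / (2 * γ) := by field_simp; ring
        _ ≤ _ := by
            have : 0 ≤ N := by linarith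
            gcongr
  have hSfin : volume S ≠ ⊤ := by
    have hSsub : S ⊆ Set.pi Set.univ fun _ => Set.Ioo (0 : ℝ) 1 := by
      rintro u ⟨hu1, hu2, -⟩ i -
      refine ⟨hu2 i, ?_⟩
      rw [Real.sqrt_lt' one_pos] at hu1
      have := Finset.single_le_sum (f := fun i => u i ^ 2) (fun i _ => sq_nonneg (u i))
        (Finset.mem_univ i)
      nlinarith [hu2 i]
    refine ne_top_of_le_ne_top ?_ (measure_mono hSsub)
    rw [Real.volume_pi_Ioo]
    simp
  have hle : lo ≤ hi := by
    intro l
    simp only [hlo, hhi]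
    split_ifs
    · norm_num
    · positivity
    · positivity
  have hvol : (volume (T '' box)).toReal = 1 / (8 * γ) * (1 / 4 * (e / 16 * (e / 16))) := by
    rw [Measure.addHaar_image_linearMap, hdet, hbox, abs_one, ENNReal.ofReal_one, one_mul,
      Real.volume_pi_Ioo_toReal hle, hprod]
    simp only [hlo, hhi, hkj, hkp.symm, hkq.symm, hjp.symm, hjq.symm, if_false, if_true]
    norm_num
  calc e ^ 2 / 8192 = γ * (volume (T '' box)).toReal := by
        rw [hvol]; field_simp; norm_num
    _ ≤ γ * (volume S).toReal := by
        gcongr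

/-- Each coordinate is bounded by the Euclidean norm. -/
lemma abs_coord_le_znorm (a : Fin 4 → ℤ) (i : Fin 4) : |(a i : ℝ)| ≤ znorm a := by
  apply Real.abs_le_sqrt
  exact Finset.single_le_sum (f := fun i => (a i : ℝ) ^ 2) (fun i _ => sq_nonneg _)
    (Finset.mem_univ i)

/-- If `a` has nonzero coordinates, not all of the same sign, then `τ(a,γ)` is bounded below in
terms of the ratio of some coordinate to the norm. -/
lemma exists_coord_tauA_ge (a : Fin 4 → ℤ) (h0 : ∀ i, a i ≠ 0)
    (hs : ¬ ((∀ i, 0 < a i) ∨ (∀ i, a i < 0))) (γ : ℝ) (hγ : 1 ≤ γ) :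
    ∃ j, ∃ e : ℝ, 0 ≤ e ∧ e ≤ 1 ∧ |(a j : ℝ)| ≤ e * znorm a ∧ e ^ 2 / 8192 ≤ tauA a γ := by
  obtain ⟨k, -, hk⟩ := Finset.exists_max_image Finset.univ (fun i => |(a i : ℝ)|)
    Finset.univ_nonempty
  simp only [Finset.mem_univ, true_imp_iff] at hk
  have hak : 0 < |(a k : ℝ)| := abs_pos.2 (by exact_mod_cast h0 k)
  suffices h : ∃ j, (|(a j : ℝ)| / |(a k : ℝ)|) ^ 2 / 8192 ≤ tauA a γ by
    obtain ⟨j, hj⟩ := h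
    refine ⟨j, _, by positivity, (div_le_one hak).2 (hk j), ?_, hj⟩
    calc |(a j : ℝ)| = |(a j : ℝ)| / |(a k : ℝ)| * |(a k : ℝ)| := by field_simp
      _ ≤ _ := by gcongr; exact abs_coord_le_znorm a k
  push Not at hs
  obtain ⟨⟨i₁, hi₁⟩, ⟨i₂, hi₂⟩⟩ := hs
  rcases lt_or_gt_of_ne (h0 k) with hneg | hpos
  · have hkneg : (a k : ℝ) < 0 := by exact_mod_cast hneg
    refine ⟨i₂, ?_⟩
    have hi : 0 < (a i₂ : ℝ) := by exact_mod_cast lt_of_le_of_ne hi₂ (h0 i₂).symm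
    have := slab_volume_ge (fun i => -(a i : ℝ)) k i₂ (by linarith) (by linarith)
      (fun l => by rw [abs_neg, ← abs_of_neg hkneg]; exact hk l) (znorm a) γ
      (by rw [← abs_of_neg hkneg]; exact abs_coord_le_znorm a k) hγ
    simp only [mul_neg, Finset.sum_neg_distrib, abs_neg] at this
    rw [abs_of_neg hkneg]
    exact this
  · have hkpos : 0 < (a k : ℝ) := by exact_mod_cast hpos
    refine ⟨i₁, ?_⟩
    have hi : (a i₁ : ℝ) < 0 := by exact_mod_cast lt_of_le_of_ne hi₁ (h0 i₁)
    rw [abs_of_pos hkpos]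
    exact slab_volume_ge (fun i => (a i : ℝ)) k i₁ hkpos hi
      (fun l => by rw [← abs_of_pos hkpos]; exact hk l) (znorm a) γ
      (by rw [← abs_of_pos hkpos]; exact abs_coord_le_znorm a k) hγ

/-- The nonzero integers of absolute value at most `R`. -/
noncomputable def nonzeroIntsUpTo (R : ℝ) : Finset ℤ := (Finset.Icc (-⌊R⌋) ⌊R⌋).erase 0

lemma mem_nonzeroIntsUpTo {R : ℝ} {n : ℤ} :
    n ∈ nonzeroIntsUpTo R ↔ n ≠ 0 ∧ |(n : ℝ)| ≤ R := by
  rw [nonzeroIntsUpTo, Finset.mem_erase, Finset.mem_Icc, ← abs_le, Int.le_floor, Int.cast_abs]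

lemma card_nonzeroIntsUpTo_le {R : ℝ} (hR : 0 ≤ R) :
    ((nonzeroIntsUpTo R).card : ℝ) ≤ 2 * R := by
  have h0 : 0 ≤ ⌊R⌋ := Int.floor_nonneg.2 hR
  have h : ((nonzeroIntsUpTo R).card : ℤ) = 2 * ⌊R⌋ := by
    rw [nonzeroIntsUpTo, Finset.card_erase_of_mem (by simp [h0]), Int.card_Icc]
    omega
  calc ((nonzeroIntsUpTo R).card : ℝ) = 2 * (⌊R⌋ : ℝ) := by exact_mod_cast h
    _ ≤ 2 * R := by gcongr; exact Int.floor_le R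

/-- Counting quadruples of nonzero integers in a cube having one coordinate in a shorter range. -/
lemma ncard_small_coord_le {A R : ℝ} (hA : 0 ≤ A) (hR : 0 ≤ R) (s : Set (Fin 4 → ℤ))
    (hs : ∀ a ∈ s, (∀ i, a i ≠ 0) ∧ (∀ i, |(a i : ℝ)| ≤ A) ∧ ∃ j, |(a j : ℝ)| ≤ R) :
    (s.ncard : ℝ) ≤ 64 * R * A ^ 3 := by
  set F : Fin 4 → Finset (Fin 4 → ℤ) := fun j => Fintype.piFinset
    (Function.update (fun _ => nonzeroIntsUpTo A) j (nonzeroIntsUpTo R)) with hF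
  have hcard : ∀ j, ((F j).card : ℝ) ≤ 16 * R * A ^ 3 := by
    intro j
    have hprod : (F j).card = (nonzeroIntsUpTo R).card * (nonzeroIntsUpTo A).card ^ 3 := by
      rw [hF, Fintype.card_piFinset, Fin.prod_univ_succAbove _ j]
      simp [Fin.succAbove_ne]
    rw [hprod]
    push_cast
    calc _ ≤ (2 * R) * (2 * A) ^ 3 := by
          gcongr
          · exact card_nonzeroIntsUpTo_le hR
          · exact card_nonzeroIntsUpTo_le hA
      _ = _ := by ring
  have hsub : s ⊆ ↑(Finset.univ.biUnion F) := by
    intro a ha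
    obtain ⟨h0, hle, j, hj⟩ := hs a ha
    simp only [Finset.coe_biUnion, Set.mem_iUnion, Finset.mem_coe, Finset.mem_univ, exists_prop,
      true_and]
    refine ⟨j, Fintype.mem_piFinset.2 fun l => ?_⟩
    rcases eq_or_ne l j with rfl | hl
    · rw [Function.update_self]
      exact mem_nonzeroIntsUpTo.2 ⟨h0 l, hj⟩
    · rw [Function.update_of_ne hl]
      exact mem_nonzeroIntsUpTo.2 ⟨h0 l, hle l⟩
  have h1 : s.ncard ≤ ∑ j, (F j).card := by
    refine (Set.ncard_le_ncard hsub (Finset.finite_toSet _)).trans ?_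
    rw [Set.ncard_coe_finset]
    exact Finset.card_biUnion_le
  calc (s.ncard : ℝ) ≤ ∑ j, ((F j).card : ℝ) := by exact_mod_cast h1
    _ ≤ ∑ _j : Fin 4, 16 * R * A ^ 3 := Finset.sum_le_sum fun j _ => hcard j
    _ = _ := by simp; ring

/-- Iterated logarithms of polynomially related quantities are comparable. -/
lemma log_log_le_two_mul {A B : ℝ} (hA : Real.exp 1 ≤ A) (hB : Real.exp (Real.exp 2) ≤ B)
    (hAB : A ≤ B ^ 3) : Real.log (Real.log A) ≤ 2 * Real.log (Real.log B) := by
  have hA0 : 0 < A := (Real.exp_pos _).trans_le hA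
  have hB0 : 0 < B := (Real.exp_pos _).trans_le hB
  have hlogB : Real.exp 2 ≤ Real.log B := (Real.le_log_iff_exp_le hB0).2 hB
  have hlogB0 : 0 < Real.log B := (Real.exp_pos _).trans_le hlogB
  have hlogA : 1 ≤ Real.log A := (Real.le_log_iff_exp_le hA0).2 hA
  have h3 : 3 ≤ Real.log B := by linarith [Real.add_one_le_exp (2 : ℝ)]
  calc Real.log (Real.log A) ≤ Real.log (3 * Real.log B) := by
        apply Real.log_le_log (by linarith)
        calc Real.log A ≤ Real.log (B ^ 3) := Real.log_le_log hA0 hAB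
          _ = _ := by rw [Real.log_pow]; norm_num
    _ ≤ Real.log (Real.log B ^ 2) := by
        apply Real.log_le_log (by positivity)
        nlinarith
    _ = _ := by rw [Real.log_pow]; norm_num

/-- Lemma 5.8: the singular integral is rarely small: for `A, B` sufficiently large
with `A ≤ B³` and any `C, κ > 0`,
`#{a ∈ 𝕃^loc(A) : 𝔍_a(B) ≤ C/(log log B)^κ} ≪ A⁴/(log log A)^{κ/3}`,
the implied constant depending at most on `C` and `κ`. -/
theorem Jfrak_rarely_small :
    ∀ C κ : ℝ, 0 < C → 0 < κ → ∃ K > (0 : ℝ), ∃ M : ℝ,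
      ∀ A B : ℝ, M ≤ A → M ≤ B → A ≤ B ^ 3 →
      (Set.ncard {a | a ∈ LlocSet A ∧
          Jfrak a B ≤ C / (Real.log (Real.log B)) ^ κ} : ℝ) ≤
        K * A ^ 4 / (Real.log (Real.log A)) ^ (κ / 3) := by
  intro C κ hC hκ
  set D : ℝ := (8192 * C) ^ (1 / 3 : ℝ) with hD
  have hD0 : 0 < D := by positivity
  refine ⟨64 * (D * 2 ^ (κ / 3)), by positivity, Real.exp (Real.exp 2), ?_⟩
  intro A B hA hB hAB
  have hA1 : Real.exp 1 < A := lt_of_lt_of_le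
    (Real.exp_lt_exp.2 (by linarith [Real.add_one_le_exp (2 : ℝ)])) hA
  have hA0 : 0 < A := (Real.exp_pos _).trans hA1
  have hB0 : 0 < B := (Real.exp_pos _).trans_le hB
  have hlogB : Real.exp 2 ≤ Real.log B := (Real.le_log_iff_exp_le hB0).2 hB
  have hlogB1 : 1 ≤ Real.log B := by linarith [Real.add_one_le_exp (2 : ℝ)]
  have hLL := log_log_le_two_mul hA1.le hB hAB
  set LA := Real.log (Real.log A)
  set LB := Real.log (Real.log B)
  have hLA : 0 < LA := Real.log_pos ((Real.lt_log_iff_exp_lt hA0).2 hA1)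
  have hLB : 0 < LB := by linarith
  have hcount := ncard_small_coord_le hA0.le (R := D / LB ^ (κ / 3) * A) (by positivity)
    {a | a ∈ LlocSet A ∧ Jfrak a B ≤ C / LB ^ κ} (by
      rintro a ⟨⟨⟨hprim, hsign, -⟩, hnorm⟩, hJ⟩
      refine ⟨hprim.1, fun i => (abs_coord_le_znorm a i).trans hnorm, ?_⟩
      obtain ⟨j, e, he0, he1, hje, htau⟩ := exists_coord_tauA_ge a hprim.1 hsign _ hlogB1
      have he3 : e ^ 3 ≤ 8192 * C / LB ^ κ := by
        have h32 : e ^ 3 ≤ e ^ 2 := pow_le_pow_of_le_one he0 he1 (by norm_num)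
        have := htau.trans hJ
        rw [mul_div_assoc]
        linarith
      have hroot : D / LB ^ (κ / 3) = (8192 * C / LB ^ κ) ^ (1 / 3 : ℝ) := by
        rw [Real.div_rpow (by positivity) (by positivity), ← Real.rpow_mul hLB.le, hD]
        ring_nf
      have he : e ≤ D / LB ^ (κ / 3) := by
        rw [hroot]
        calc e = (e ^ 3) ^ (1 / 3 : ℝ) := by
              rw [← Real.rpow_natCast, ← Real.rpow_mul he0]
              norm_num
          _ ≤ _ := by gcongr
      exact ⟨j, hje.trans (mul_le_mul he hnorm (Real.sqrt_nonneg _) (by positivity))⟩)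
  refine hcount.trans ?_
  have hpow : LA ^ (κ / 3) ≤ 2 ^ (κ / 3) * LB ^ (κ / 3) := by
    rw [← Real.mul_rpow (by norm_num) hLB.le]
    gcongr
  have hLA' : 0 < LA ^ (κ / 3) := by positivity
  have hLB' : 0 < LB ^ (κ / 3) := by positivity
  calc 64 * (D / LB ^ (κ / 3) * A) * A ^ 3 = 64 * D * A ^ 4 * (1 / LB ^ (κ / 3)) := by ring
    _ ≤ 64 * D * A ^ 4 * (2 ^ (κ / 3) / LA ^ (κ / 3)) := by
        gcongr ?_ * ?_
        rw [div_le_div_iff₀ hLB' hLA', one_mul]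
        exact hpow
    _ = _ := by ring
end
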